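/- arXiv:1107.4989 — 4 statements merged into one kernel-verified Lean document; each statement's English description precedes it below -/
import Mathlib

section
/- Under the setting of the Main Theorem's proof (f : Iⁿ → I continuous, symmetric, cancellative, associative; g its n-associative extension with g₁ = id; c ∈ I with c < f(cⁿ)), for each x ∈ I the set S_x = {(p-q)/k : k, p, q+1 ∈ Aₙ and g(c^p) > g(x^k c^q)} is well-defined in the sense that whether (p-q)/k belongs to S_x does not depend on the chosen representation: if (p-q)/k = (p'-q')/k' with k, p, q+1, k', p', q'+1 ∈ Aₙ, then g(c^p) > g(x^k c^q) if and only if g(c^(p')) > g(x^(k') c^(q')). -/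
/-- `f : Iⁿ → I` is associative in the `n`-ary sense: for each `i` with `i+1 < n`,
substituting `f` into positions `i` or `i+1` of a `(2n-1)`-tuple over `I` gives
the same result. -/
def NAssocOn (n : ℕ) (I : Set ℝ) (f : (Fin n → ℝ) → ℝ) : Prop :=
  ∀ x : ℕ → ℝ, (∀ j, j < 2 * n - 1 → x j ∈ I) → ∀ i : ℕ, i + 1 < n →
    f (fun j : Fin n => if (j : ℕ) < i then x j
        else if (j : ℕ) = i then f (fun l : Fin n => x (i + (l : ℕ)))
        else x ((j : ℕ) + n - 1)) =
    f (fun j : Fin n => if (j : ℕ) < i + 1 then x j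
        else if (j : ℕ) = i + 1 then f (fun l : Fin n => x (i + 1 + (l : ℕ)))
        else x ((j : ℕ) + n - 1))

/-- `f` is symmetric on `Iⁿ`: invariant under all permutations of its arguments. -/
def SymmOn (n : ℕ) (I : Set ℝ) (f : (Fin n → ℝ) → ℝ) : Prop :=
  ∀ x : Fin n → ℝ, (∀ i, x i ∈ I) → ∀ σ : Equiv.Perm (Fin n), f (x ∘ σ) = f x

/-- `f` is cancellative on `Iⁿ`: one-to-one in each variable. -/
def CancOn (n : ℕ) (I : Set ℝ) (f : (Fin n → ℝ) → ℝ) : Prop :=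
  ∀ k : Fin n, ∀ x x' : Fin n → ℝ, (∀ i, x i ∈ I) → (∀ i, x' i ∈ I) →
    (∀ i, i ≠ k → x i = x' i) → f x = f x' → x k = x' k

/-- The abstract properties of `g` used in the proof (`N = n - 1`). -/
structure GProp (N : ℕ) (I : Set ℝ) (g : List ℝ → ℝ) : Prop where
  pos : 1 ≤ N
  one : ∀ a : ℝ, g [a] = a
  rec' : ∀ (l r : List ℝ) (m : ℕ), l.length = 1 + N * m → r.length = N →
      g (l ++ r) = g (g l :: r)
  swap : ∀ (l₁ : List ℝ) (a b : ℝ) (l₂ : List ℝ), (∀ y ∈ l₁ ++ a :: b :: l₂, y ∈ I) →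
      (l₁ ++ a :: b :: l₂).length = N + 1 → g (l₁ ++ a :: b :: l₂) = g (l₁ ++ b :: a :: l₂)
  mem : ∀ l : List ℝ, (∀ y ∈ l, y ∈ I) → l.length = N + 1 → g l ∈ I
  ass : ∀ (t : ℝ) (s : List ℝ) (b : ℝ) (r : List ℝ), t ∈ I → (∀ y ∈ s, y ∈ I) → b ∈ I →
      (∀ y ∈ r, y ∈ I) → s.length = N → r.length + 1 = N →
      g (g (t :: s) :: b :: r) = g (t :: g (s ++ [b]) :: r)
  mono : ∀ (a b : ℝ) (r : List ℝ), a ∈ I → b ∈ I → a < b → (∀ y ∈ r, y ∈ I) →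
      r.length = N → g (a :: r) < g (b :: r)

theorem list_split_right (l : List ℝ) (k : ℕ) (h : k ≤ l.length) :
    ∃ s t : List ℝ, l = s ++ t ∧ t.length = k :=
  ⟨l.take (l.length - k), l.drop (l.length - k), (List.take_append_drop _ _).symm, by
    rw [List.length_drop]; omega⟩

theorem list_split_left (l : List ℝ) (k : ℕ) (h : k ≤ l.length) :
    ∃ s t : List ℝ, l = s ++ t ∧ s.length = k :=
  ⟨l.take k, l.drop k, (List.take_append_drop _ _).symm, by
    rw [List.length_take]; omega⟩

theorem GProp.mem_all {N : ℕ} {I : Set ℝ} {g : List ℝ → ℝ} (h : GProp N I g) (m : ℕ) :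
    ∀ l : List ℝ, (∀ y ∈ l, y ∈ I) → l.length = 1 + N * m → g l ∈ I := by
  induction m with
  | zero =>
    intro l hl hlen
    obtain ⟨a, rfl⟩ := List.length_eq_one_iff.1 (by simpa using hlen)
    rw [h.one]; exact hl a (by simp)
  | succ m ih =>
    intro l hl hlen
    rw [Nat.mul_succ] at hlen
    obtain ⟨s, t, rfl, ht⟩ := list_split_right l N (by omega)
    rw [List.length_append] at hlen
    have hs : s.length = 1 + N * m := by omega
    rw [h.rec' s t m hs ht]
    refine h.mem _ ?_ (by simp [ht])
    intro y hy
    rcases List.mem_cons.1 hy with rfl | hy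
    · exact ih s (fun y hy => hl y (by simp [hy])) hs
    · exact hl y (by simp [hy])

theorem GProp.swap_all {N : ℕ} {I : Set ℝ} {g : List ℝ → ℝ} (h : GProp N I g) (m : ℕ) :
    ∀ (l₁ : List ℝ) (a b : ℝ) (l₂ : List ℝ), (∀ y ∈ l₁ ++ a :: b :: l₂, y ∈ I) →
      (l₁ ++ a :: b :: l₂).length = 1 + N * m →
      g (l₁ ++ a :: b :: l₂) = g (l₁ ++ b :: a :: l₂) := by
  have hN := h.pos
  induction m with
  | zero => intro l₁ a b l₂ _ hlen; simp at hlen; omega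
  | succ m ih =>
    intro l₁ a b l₂ hI hlen
    rw [Nat.mul_succ] at hlen
    simp only [List.length_append, List.length_cons] at hlen
    by_cases h2 : N ≤ l₂.length
    · obtain ⟨s, t, rfl, ht⟩ := list_split_right l₂ N h2
      rw [List.length_append] at hlen
      have e1 : l₁ ++ a :: b :: (s ++ t) = (l₁ ++ a :: b :: s) ++ t := by simp
      have e2 : l₁ ++ b :: a :: (s ++ t) = (l₁ ++ b :: a :: s) ++ t := by simp
      rw [e1, e2, h.rec' _ t m (by simp; omega) ht, h.rec' _ t m (by simp; omega) ht,
        ih l₁ a b s (fun y hy => hI y (by rw [e1]; exact List.mem_append_left _ hy))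
          (by simp; omega)]
    · by_cases h3 : l₂.length + 2 ≤ N
      · obtain ⟨s, t, rfl, ht⟩ := list_split_right l₁ (N - 2 - l₂.length) (by omega)
        rw [List.length_append] at hlen
        rw [List.append_assoc, List.append_assoc, h.rec' s _ m (by omega) (by simp; omega),
          h.rec' s _ m (by omega) (by simp; omega)]
        have := h.swap (g s :: t) a b l₂ ?_ (by simp; omega)
        · simpa using this
        · intro y hy
          rw [List.cons_append] at hy
          rcases List.mem_cons.1 hy with rfl | hy
          · exact h.mem_all m s (fun y hy => hI y (by simp [hy])) (by omega)
          · exact hI y (by rw [List.append_assoc]; exact List.mem_append_right _ hy)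
      · have hl2 : l₂.length + 1 = N := by omega
        rcases m with _ | m
        · exact h.swap l₁ a b l₂ hI (by simp; omega)
        · rw [Nat.mul_succ] at hlen
          obtain ⟨t, s, rfl, hs⟩ := list_split_right l₁ (N - 1) (by omega)
          rw [List.length_append] at hlen
          have ht : t.length = 1 + N * m := by omega
          have htI : g t ∈ I := h.mem_all m t (fun y hy => hI y (by simp [hy])) ht
          have key : ∀ a b : ℝ, a ∈ I → b ∈ I →
              g (t ++ s ++ a :: b :: l₂) = g (g t :: g (s ++ [a, b]) :: l₂) := by
            intro a b ha hb
            have e : t ++ s ++ a :: b :: l₂ = (t ++ (s ++ [a])) ++ b :: l₂ := by simp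
            rw [e, h.rec' _ (b :: l₂) (m + 1) (by simp [Nat.mul_succ]; omega) (by simp [hl2]),
              h.rec' t (s ++ [a]) m ht (by simp; omega), h.ass _ _ _ _ htI _ hb _ _ hl2]
            · simp
            · intro y hy
              rcases List.mem_append.1 hy with hy | hy
              · exact hI y (by simp [hy])
              · simp at hy; rwa [hy]
            · intro y hy; exact hI y (by simp [hy])
            · simp; omega
          have ha : a ∈ I := hI a (by simp)
          have hb : b ∈ I := hI b (by simp)
          rw [key a b ha hb, key b a hb ha, h.swap s a b [] _ (by simp; omega)]
          intro y hy
          apply hI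
          simp at hy ⊢
          tauto

theorem GProp.perm_aux {N : ℕ} {I : Set ℝ} {g : List ℝ → ℝ} (h : GProp N I g) (m : ℕ)
    {l l' : List ℝ} (hp : l.Perm l') :
    ∀ pre : List ℝ, (∀ y ∈ pre ++ l, y ∈ I) → (pre ++ l).length = 1 + N * m →
      g (pre ++ l) = g (pre ++ l') := by
  induction hp with
  | nil => intros; rfl
  | cons a _ ih =>
    intro pre hI hlen
    have := ih (pre ++ [a]) (by simpa using hI) (by simpa using hlen)
    simpa using this
  | swap a b l => intro pre hI hlen; exact h.swap_all m pre b a l hI hlen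
  | trans h1 _ ih1 ih2 =>
    intro pre hI hlen
    rw [ih1 pre hI hlen]
    have hp := List.Perm.append_left pre h1
    exact ih2 pre (fun y hy => hI y (hp.mem_iff.2 hy)) (by rw [← hlen]; exact hp.length_eq.symm)

theorem GProp.perm {N : ℕ} {I : Set ℝ} {g : List ℝ → ℝ} (h : GProp N I g) (m : ℕ)
    {l l' : List ℝ} (hp : l.Perm l') (hI : ∀ y ∈ l, y ∈ I) (hl : l.length = 1 + N * m) :
    g l = g l' := by
  simpa using h.perm_aux m hp [] (by simpa using hI) (by simpa using hl)

theorem GProp.lt_append {N : ℕ} {I : Set ℝ} {g : List ℝ → ℝ} (h : GProp N I g) (j : ℕ) :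
    ∀ (u v w : List ℝ) (m m' : ℕ), (∀ y ∈ u, y ∈ I) → (∀ y ∈ v, y ∈ I) → (∀ y ∈ w, y ∈ I) →
      u.length = 1 + N * m → v.length = 1 + N * m' → w.length = N * j → g u < g v →
      g (u ++ w) < g (v ++ w) := by
  induction j with
  | zero =>
    intro u v w m m' _ _ _ _ _ hw hlt
    have : w = [] := by simpa using hw
    simpa [this] using hlt
  | succ j ih =>
    intro u v w m m' hu hv hw hul hvl hwl hlt
    rw [Nat.mul_succ] at hwl
    obtain ⟨r, t, rfl, hr⟩ := list_split_left w N (by omega)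
    rw [List.length_append] at hwl
    rw [← List.append_assoc, ← List.append_assoc]
    have hrI : ∀ y ∈ r, y ∈ I := fun y hy => hw y (by simp [hy])
    refine ih (u ++ r) (v ++ r) t (m + 1) (m' + 1) ?_ ?_ (fun y hy => hw y (by simp [hy]))
      (by simp [Nat.mul_succ]; omega) (by simp [Nat.mul_succ]; omega) (by omega) ?_
    · intro y hy; rcases List.mem_append.1 hy with hy | hy
      exacts [hu y hy, hrI y hy]
    · intro y hy; rcases List.mem_append.1 hy with hy | hy
      exacts [hv y hy, hrI y hy]
    · rw [h.rec' u r m hul hr, h.rec' v r m' hvl hr]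
      exact h.mono _ _ r (h.mem_all m u hu hul) (h.mem_all m' v hv hvl) hlt hrI hr

/-- Equality version of `lt_append`. -/
theorem GProp.eq_append {N : ℕ} {I : Set ℝ} {g : List ℝ → ℝ} (h : GProp N I g) (j : ℕ) :
    ∀ (u v w : List ℝ) (m m' : ℕ),
      u.length = 1 + N * m → v.length = 1 + N * m' → w.length = N * j → g u = g v →
      g (u ++ w) = g (v ++ w) := by
  induction j with
  | zero =>
    intro u v w m m' _ _ hw hlt
    have : w = [] := by simpa using hw
    simpa [this] using hlt
  | succ j ih =>
    intro u v w m m' hul hvl hwl hlt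
    rw [Nat.mul_succ] at hwl
    obtain ⟨r, t, rfl, hr⟩ := list_split_left w N (by omega)
    rw [List.length_append] at hwl
    rw [← List.append_assoc, ← List.append_assoc]
    refine ih (u ++ r) (v ++ r) t (m + 1) (m' + 1)
      (by simp [Nat.mul_succ]; omega) (by simp [Nat.mul_succ]; omega) (by omega) ?_
    rw [h.rec' u r m hul hr, h.rec' v r m' hvl hr, hlt]

theorem GProp.lt_append_iff {N : ℕ} {I : Set ℝ} {g : List ℝ → ℝ} (h : GProp N I g)
    (j m m' : ℕ) (u v w : List ℝ) (hu : ∀ y ∈ u, y ∈ I) (hv : ∀ y ∈ v, y ∈ I)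
    (hw : ∀ y ∈ w, y ∈ I) (hul : u.length = 1 + N * m) (hvl : v.length = 1 + N * m')
    (hwl : w.length = N * j) : g (u ++ w) < g (v ++ w) ↔ g u < g v := by
  constructor
  · intro hlt
    rcases lt_trichotomy (g u) (g v) with h1 | h1 | h1
    · exact h1
    · exact absurd (h.eq_append j u v w m m' hul hvl hwl h1) hlt.ne
    · exact absurd (h.lt_append j v u w m' m hv hu hw hvl hul hwl h1) hlt.not_gt
  · exact h.lt_append j u v w m m' hu hv hw hul hvl hwl

/-- The list `x^k c^q`. -/
def xc (x c : ℝ) (k q : ℕ) : List ℝ := List.replicate k x ++ List.replicate q c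

theorem xc_length (x c : ℝ) (k q : ℕ) : (xc x c k q).length = k + q := by simp [xc]

theorem xc_mem {I : Set ℝ} {x c : ℝ} (hx : x ∈ I) (hc : c ∈ I) (k q : ℕ) :
    ∀ y ∈ xc x c k q, y ∈ I := by
  intro y hy
  simp only [xc, List.mem_append, List.mem_replicate] at hy
  rcases hy with ⟨_, rfl⟩ | ⟨_, rfl⟩ <;> assumption

theorem xc_perm (x c : ℝ) (k q k' q' : ℕ) :
    (xc x c k q ++ xc x c k' q').Perm (xc x c (k + k') (q + q')) := by
  classical
  rw [List.perm_iff_count]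
  intro a
  simp only [xc, List.count_append, List.count_replicate]
  split_ifs <;> omega

theorem GProp.lt_xc_iff {N : ℕ} {I : Set ℝ} {g : List ℝ → ℝ} (h : GProp N I g)
    {x c : ℝ} (hx : x ∈ I) (hc : c ∈ I) (k q k' q' k'' q'' m m' j : ℕ)
    (h1 : k + q = 1 + N * m) (h2 : k' + q' = 1 + N * m') (h3 : k'' + q'' = N * j) :
    g (xc x c (k + k'') (q + q'')) < g (xc x c (k' + k'') (q' + q'')) ↔
      g (xc x c k q) < g (xc x c k' q') := by
  rw [← h.lt_append_iff j m m' (xc x c k q) (xc x c k' q') (xc x c k'' q'') (xc_mem hx hc _ _)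
    (xc_mem hx hc _ _) (xc_mem hx hc _ _) (by rw [xc_length, h1]) (by rw [xc_length, h2])
    (by rw [xc_length, h3])]
  rw [h.perm (m + j) (xc_perm x c k q k'' q''), h.perm (m' + j) (xc_perm x c k' q' k'' q'')]
  · intro y hy
    rcases List.mem_append.1 hy with hy | hy
    exacts [xc_mem hx hc _ _ y hy, xc_mem hx hc _ _ y hy]
  · rw [List.length_append, xc_length, xc_length, h2, h3]; ring
  · intro y hy
    rcases List.mem_append.1 hy with hy | hy
    exacts [xc_mem hx hc _ _ y hy, xc_mem hx hc _ _ y hy]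
  · rw [List.length_append, xc_length, xc_length, h1, h3]; ring

/-- Passing to a power: `u < v → u^(i+1) v^d < v^(i+1+d)` for total exponent `1 + N e`. -/
theorem GProp.lt_pow {N : ℕ} {I : Set ℝ} {g : List ℝ → ℝ} (h : GProp N I g)
    {x c : ℝ} (hx : x ∈ I) (hc : c ∈ I) (k q k' q' m m' e : ℕ)
    (h1 : k + q = 1 + N * m) (h2 : k' + q' = 1 + N * m')
    (hlt : g (xc x c k q) < g (xc x c k' q')) (i : ℕ) :
    ∀ d : ℕ, i + 1 + d = 1 + N * e →
      g (xc x c (k * (i + 1) + k' * d) (q * (i + 1) + q' * d)) <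
        g (xc x c (k' * (i + 1 + d)) (q' * (i + 1 + d))) := by
  have step : ∀ i d : ℕ, i + 1 + d = 1 + N * e →
      g (xc x c (k * (i + 1) + k' * d) (q * (i + 1) + q' * d)) <
        g (xc x c (k * i + k' * (d + 1)) (q * i + q' * (d + 1))) := by
    intro i d hid
    have hid' : i + d = N * e := by omega
    have hj : (k * i + k' * d) + (q * i + q' * d) = N * (e + m * i + m' * d) := by
      calc (k * i + k' * d) + (q * i + q' * d) = (k + q) * i + (k' + q') * d := by ring
        _ = (i + d) + N * (m * i + m' * d) := by rw [h1, h2]; ring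
        _ = _ := by rw [hid']; ring
    have := (h.lt_xc_iff hx hc k q k' q' (k * i + k' * d) (q * i + q' * d) m m' _ h1 h2 hj).2 hlt
    convert this using 3 <;> ring
  induction i with
  | zero =>
    intro d hd
    have := step 0 d hd
    have e : d + 1 = 0 + 1 + d := by ring
    rw [e] at this
    simpa only [Nat.mul_zero, Nat.zero_add] using this
  | succ i ih =>
    intro d hd
    refine (step (i + 1) d hd).trans ?_
    have := ih (d + 1) (by omega)
    have e : i + 1 + (d + 1) = i + 1 + 1 + d := by ring
    rw [e] at this
    exact this

theorem GProp.lt_pow_iff {N : ℕ} {I : Set ℝ} {g : List ℝ → ℝ} (h : GProp N I g)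
    {x c : ℝ} (hx : x ∈ I) (hc : c ∈ I) (k q k' q' m m' e s : ℕ)
    (h1 : k + q = 1 + N * m) (h2 : k' + q' = 1 + N * m') (hs : s = 1 + N * e) :
    g (xc x c (k * s) (q * s)) < g (xc x c (k' * s) (q' * s)) ↔
      g (xc x c k q) < g (xc x c k' q') := by
  have main : ∀ k q k' q' m m' : ℕ, k + q = 1 + N * m → k' + q' = 1 + N * m' →
      g (xc x c k q) < g (xc x c k' q') →
      g (xc x c (k * s) (q * s)) < g (xc x c (k' * s) (q' * s)) := by
    intro k q k' q' m m' h1 h2 hlt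
    have := h.lt_pow hx hc k q k' q' m m' e h1 h2 hlt (N * e) 0 (by omega)
    have es : N * e + 1 = s := by omega
    simpa [es] using this
  refine ⟨fun hlt => ?_, main k q k' q' m m' h1 h2⟩
  rcases lt_trichotomy (g (xc x c k q)) (g (xc x c k' q')) with h3 | h3 | h3
  · exact h3
  · exfalso
    -- replace the blocks one at a time by equal ones
    have step : ∀ i d : ℕ, i + 1 + d = 1 + N * e →
        g (xc x c (k * (i + 1) + k' * d) (q * (i + 1) + q' * d)) =
          g (xc x c (k * i + k' * (d + 1)) (q * i + q' * (d + 1))) := by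
      intro i d hid
      have hid' : i + d = N * e := by omega
      have hj : (k * i + k' * d) + (q * i + q' * d) = N * (e + m * i + m' * d) := by
        calc (k * i + k' * d) + (q * i + q' * d) = (k + q) * i + (k' + q') * d := by ring
          _ = (i + d) + N * (m * i + m' * d) := by rw [h1, h2]; ring
          _ = _ := by rw [hid']; ring
      have A := h.lt_xc_iff hx hc k q k' q' (k * i + k' * d) (q * i + q' * d) m m' _ h1 h2 hj
      have B := h.lt_xc_iff hx hc k' q' k q (k * i + k' * d) (q * i + q' * d) m' m _ h2 h1 hj
      have A' := mt A.1 (by rw [h3]; exact lt_irrefl _)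
      have B' := mt B.1 (by rw [h3]; exact lt_irrefl _)
      have := le_antisymm (not_lt.1 B') (not_lt.1 A')
      convert this using 3 <;> ring
    have all : ∀ i d : ℕ, i + d = 1 + N * e →
        g (xc x c (k * i + k' * d) (q * i + q' * d)) =
          g (xc x c (k' * (i + d)) (q' * (i + d))) := by
      intro i
      induction i with
      | zero => intro d _; simp
      | succ i ih =>
        intro d hd
        rw [step i d hd, ih (d + 1) (by omega)]
        congr 2 <;> ring
    have := all s 0 (by omega)
    simp at this
    exact hlt.ne this
  · exact absurd (main k' q' k q m' m h2 h1 h3) hlt.not_gt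

theorem GProp.final {N : ℕ} {I : Set ℝ} {g : List ℝ → ℝ} (h : GProp N I g)
    {x c : ℝ} (hx : x ∈ I) (hc : c ∈ I) (k p q k' p' q' a b d a' b' d' : ℕ)
    (hk : k = 1 + N * a) (hp : p = 1 + N * b) (hq : q = N * d)
    (hk' : k' = 1 + N * a') (hp' : p' = 1 + N * b') (hq' : q' = N * d')
    (heq : p * k' + q' * k = p' * k + q * k') :
    g (xc x c k q) < g (xc x c 0 p) ↔ g (xc x c k' q') < g (xc x c 0 p') := by
  rw [← h.lt_pow_iff hx hc k q 0 p (a + d) b a' k' (by rw [hk, hq]; ring) (by omega) hk',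
    ← h.lt_pow_iff hx hc k' q' 0 p' (a' + d') b' a k (by rw [hk', hq']; ring) (by omega) hk,
    ← h.lt_xc_iff hx hc (k * k') (q * k') (0 * k') (p * k') 0 (q' * k)
      (a + a' + N * a * a' + d * k') (b + a' + N * b * a') (d' * k)
      (by rw [hk, hk', hq]; ring) (by rw [hk', hp]; ring) (by rw [hq']; ring),
    ← h.lt_xc_iff hx hc (k' * k) (q' * k) (0 * k) (p' * k) 0 (q * k')
      (a + a' + N * a * a' + d' * k) (b' + a + N * b' * a) (d * k')
      (by rw [hk, hk', hq']; ring) (by rw [hk, hp']; ring) (by rw [hq]; ring)]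
  rw [heq, mul_comm k' k, add_comm (q' * k) (q * k')]
  simp

/-- A cancellative continuous function is strictly monotone in the first variable, with a
direction that does not depend on the other variables. -/
theorem mono_dichotomy (n : ℕ) (z : Fin n) (I : Set ℝ) (hI : I.OrdConnected)
    (f : (Fin n → ℝ) → ℝ) (hcont : ContinuousOn f {x | ∀ i, x i ∈ I}) (hcanc : CancOn n I f) :
    (∀ a ∈ I, ∀ b ∈ I, ∀ x : Fin n → ℝ, (∀ i, x i ∈ I) → a < b →
      f (Function.update x z a) < f (Function.update x z b)) ∨
    (∀ a ∈ I, ∀ b ∈ I, ∀ x : Fin n → ℝ, (∀ i, x i ∈ I) → a < b →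
      f (Function.update x z b) < f (Function.update x z a)) := by
  let T : Set (ℝ × ℝ × (Fin n → ℝ)) :=
    {t | t.1 ∈ I ∧ t.2.1 ∈ I ∧ t.1 < t.2.1 ∧ ∀ i, t.2.2 i ∈ I}
  have hIc : Convex ℝ I := hI.convex
  have hT : Convex ℝ T := by
    rintro ⟨a, b, x⟩ ⟨h1, h2, h3, h4⟩ ⟨a', b', x'⟩ ⟨h1', h2', h3', h4'⟩ s t hs ht hst
    refine ⟨hIc h1 h1' hs ht hst, hIc h2 h2' hs ht hst, ?_,
      fun i => hIc (h4 i) (h4' i) hs ht hst⟩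
    simp only [Prod.fst_add, Prod.smul_fst, Prod.snd_add, Prod.smul_snd, smul_eq_mul] at *
    rcases hs.eq_or_lt with rfl | hs
    · have : t = 1 := by linarith
      subst this; linarith
    · nlinarith [mul_lt_mul_of_pos_left h3 hs, mul_le_mul_of_nonneg_left h3'.le ht]
  have hup : ∀ (x : Fin n → ℝ) (a : ℝ), (∀ i, x i ∈ I) → a ∈ I →
      ∀ i, Function.update x z a i ∈ I := by
    intro x a hx ha i
    by_cases hi : i = z
    · subst hi; simpa using ha
    · simpa [hi] using hx i
  let D : ℝ × ℝ × (Fin n → ℝ) → ℝ := fun t =>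
    f (Function.update t.2.2 z t.2.1) - f (Function.update t.2.2 z t.1)
  have hD : ContinuousOn D T := by
    refine ContinuousOn.sub ?_ ?_
    · refine hcont.comp (Continuous.continuousOn ?_) (fun t ht => hup _ _ ht.2.2.2 ht.2.1)
      fun_prop
    · refine hcont.comp (Continuous.continuousOn ?_) (fun t ht => hup _ _ ht.2.2.2 ht.1)
      fun_prop
  have hne : ∀ t ∈ T, D t ≠ 0 := by
    rintro ⟨a, b, x⟩ ⟨h1, h2, h3, h4⟩ h0
    have := hcanc z (Function.update x z b) (Function.update x z a) (hup _ _ h4 h2) (hup _ _ h4 h1)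
      (fun i hi => by simp [hi]) (sub_eq_zero.1 h0)
    simp at this h3
    exact h3.ne' this
  have hpre : IsPreconnected (D '' T) := hT.isPreconnected.image D hD
  by_cases hpos : ∃ t ∈ T, 0 < D t
  · obtain ⟨t₀, ht₀, hp⟩ := hpos
    left
    intro a ha b hb x hx hab
    by_contra hcon
    have ht : (a, b, x) ∈ T := ⟨ha, hb, hab, hx⟩
    have hle : D (a, b, x) ≤ 0 := by
      simp only [D]; linarith [not_lt.1 hcon]
    obtain ⟨t, ht, h0⟩ := hpre.ordConnected.out (Set.mem_image_of_mem D ht)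
      (Set.mem_image_of_mem D ht₀) ⟨hle, hp.le⟩
    exact hne t ht h0
  · push Not at hpos
    right
    intro a ha b hb x hx hab
    have ht : (a, b, x) ∈ T := ⟨ha, hb, hab, hx⟩
    have := lt_of_le_of_ne (hpos _ ht) (hne _ ht)
    simp only [D] at this
    linarith

theorem exists_eq_of_mod {N k : ℕ} (hk : 1 ≤ k) (h : k % N = 1 % N) : ∃ a, k = 1 + N * a := by
  have h1 : N ∣ k - 1 := (Nat.modEq_iff_dvd' hk).1 (show 1 ≡ k [MOD N] from h.symm)
  obtain ⟨a, ha⟩ := h1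
  exact ⟨a, by omega⟩

theorem gprop_of (n : ℕ) (hn : 2 ≤ n) (I : Set ℝ) (hI : I.OrdConnected)
    (hne : ∃ a ∈ I, ∃ b ∈ I, a ≠ b)
    (f : (Fin n → ℝ) → ℝ)
    (hmap : ∀ x : Fin n → ℝ, (∀ i, x i ∈ I) → f x ∈ I)
    (hcont : ContinuousOn f {x | ∀ i, x i ∈ I})
    (hsym : SymmOn n I f) (hcanc : CancOn n I f) (hassoc : NAssocOn n I f)
    (g : List ℝ → ℝ)
    (hg1 : ∀ a : ℝ, g [a] = a)
    (hgn : ∀ l : List ℝ, l.length = n → g l = f (fun i : Fin n => l.getD (i : ℕ) 0))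
    (hgrec : ∀ l r : List ℝ, l ≠ [] → l.length % (n - 1) = 1 % (n - 1) →
      r.length = n - 1 → g (l ++ r) = g (g l :: r)) : GProp (n - 1) I g := by
  obtain ⟨N, rfl⟩ : ∃ N, n = N + 1 := ⟨n - 1, by omega⟩
  simp only [Nat.add_sub_cancel] at hgrec ⊢
  have hget : ∀ l : List ℝ, (∀ y ∈ l, y ∈ I) → l.length = N + 1 →
      ∀ i : Fin (N + 1), l.getD (i : ℕ) 0 ∈ I := by
    intro l hl hlen i
    rw [List.getD_eq_getElem _ _ (by omega)]
    exact hl _ (List.getElem_mem _)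
  have hmem : ∀ l : List ℝ, (∀ y ∈ l, y ∈ I) → l.length = N + 1 → g l ∈ I := by
    intro l hl hlen
    rw [hgn l hlen]
    exact hmap _ (hget l hl hlen)
  have hass : ∀ (t : ℝ) (s : List ℝ) (b : ℝ) (r : List ℝ), t ∈ I → (∀ y ∈ s, y ∈ I) → b ∈ I →
      (∀ y ∈ r, y ∈ I) → s.length = N → r.length + 1 = N →
      g (g (t :: s) :: b :: r) = g (t :: g (s ++ [b]) :: r) := by
    intro t s b r ht hs hb hr hsl hrl
    have hL : ∀ y ∈ t :: (s ++ b :: r), y ∈ I := by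
      intro y hy
      simp only [List.mem_cons, List.mem_append] at hy
      rcases hy with rfl | hy | rfl | hy
      exacts [ht, hs y hy, hb, hr y hy]
    have hLl : (t :: (s ++ b :: r)).length = 2 * (N + 1) - 1 := by simp; omega
    have := hassoc (fun j => (t :: (s ++ b :: r)).getD j 0) (by
      intro j hj
      rw [List.getD_eq_getElem _ _ (by omega)]
      exact hL _ (List.getElem_mem _)) 0 (by omega)
    rw [hgn (g (t :: s) :: b :: r) (by simp; omega), hgn (t :: g (s ++ [b]) :: r) (by simp; omega),
      hgn (t :: s) (by simp; omega), hgn (s ++ [b]) (by simp; omega)]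
    convert this using 2
    · funext j
      rcases j with ⟨_ | j, hj⟩
      · simp
        congr 1
        funext l
        rcases l with ⟨_ | l, hl⟩
        · simp
        · simp [List.getElem?_append, show l < s.length by omega]
      · have e : j + 1 + N = (s.length + j) + 1 := by omega
        simp [e, List.getElem?_append_right]
    · funext j
      rcases j with ⟨_ | _ | j, hj⟩
      · simp
      · simp
        congr 1
        funext l
        rcases l with ⟨l, hl⟩
        rw [show 1 + l = l + 1 by omega]
        simp [List.getElem?_append]
        by_cases h : l < s.length
        · simp [h]
        · simp [h, show l - s.length = 0 by omega]
      · have e : j + 1 + 1 + N = (s.length + (j + 1)) + 1 := by omega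
        simp [e, List.getElem?_append_right]
  have hz : ∀ (d a : ℝ) (r : List ℝ), (fun i : Fin (N + 1) => (a :: r).getD (i : ℕ) 0) =
      Function.update (fun i : Fin (N + 1) => (d :: r).getD (i : ℕ) 0) 0 a := by
    intro d a r
    funext i
    refine Fin.cases ?_ (fun i => ?_) i
    · simp
    · simp [Fin.succ_ne_zero]
  obtain ⟨a₀, ha₀, b₀, hb₀, hab₀⟩ : ∃ a ∈ I, ∃ b ∈ I, a < b := by
    obtain ⟨a, ha, b, hb, hab⟩ := hne
    rcases lt_or_gt_of_ne hab with h | h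
    exacts [⟨a, ha, b, hb, h⟩, ⟨b, hb, a, ha, h⟩]
  have hmono : ∀ (a b : ℝ) (r : List ℝ), a ∈ I → b ∈ I → a < b → (∀ y ∈ r, y ∈ I) →
      r.length = N → g (a :: r) < g (b :: r) := by
    rcases mono_dichotomy (N + 1) 0 I hI f hcont hcanc with hd | hd
    · intro a b r ha hb hab hr hrl
      rw [hgn _ (by simp [hrl]), hgn _ (by simp [hrl]), hz a b r]
      conv_lhs => rw [hz a a r]
      exact hd a ha b hb _ (hget _ (by simpa [ha] using hr) (by simp [hrl])) hab
    · exfalso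
      have anti : ∀ (a b : ℝ) (r : List ℝ), a ∈ I → b ∈ I → a < b → (∀ y ∈ r, y ∈ I) →
          r.length = N → g (b :: r) < g (a :: r) := by
        intro a b r ha hb hab hr hrl
        rw [hgn _ (by simp [hrl]), hgn _ (by simp [hrl]), hz a b r]
        conv_rhs => rw [hz a a r]
        exact hd a ha b hb _ (hget _ (by simpa [ha] using hr) (by simp [hrl])) hab
      have hs : ∀ k : ℕ, ∀ y ∈ List.replicate k a₀, y ∈ I := by
        intro k y hy
        rw [(List.mem_replicate.1 hy).2]; exact ha₀
      have hcs : ∀ a ∈ I, ∀ k : ℕ, ∀ y ∈ a :: List.replicate k a₀, y ∈ I := by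
        intro a ha k y hy
        rcases List.mem_cons.1 hy with rfl | hy
        exacts [ha, hs k y hy]
      have ass : ∀ a ∈ I, g (g (a :: List.replicate N a₀) :: a₀ :: List.replicate (N - 1) a₀) =
          g (a :: g (List.replicate N a₀ ++ [a₀]) :: List.replicate (N - 1) a₀) := fun a ha =>
        hass a _ a₀ _ ha (hs _) ha₀ (hs _) (by simp) (by simp; omega)
      have e : g (List.replicate N a₀ ++ [a₀]) ∈ I := by
        apply hmem _ _ (by simp)
        intro y hy
        rcases List.mem_append.1 hy with hy | hy
        · exact hs N y hy
        · simp at hy; rwa [hy]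
      have h1 := anti a₀ b₀ _ ha₀ hb₀ hab₀ (hcs _ e (N - 1)) (by simp; omega)
      rw [← ass a₀ ha₀, ← ass b₀ hb₀] at h1
      have h2 := anti _ _ (a₀ :: List.replicate (N - 1) a₀)
        (hmem _ (hcs b₀ hb₀ N) (by simp)) (hmem _ (hcs a₀ ha₀ N) (by simp))
        (anti a₀ b₀ _ ha₀ hb₀ hab₀ (hs N) (by simp)) (hcs _ ha₀ (N - 1)) (by simp; omega)
      exact lt_asymm h1 h2
  refine ⟨by omega, hg1, ?_, ?_, hmem, hass, hmono⟩
  · intro l r m hl hr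
    refine hgrec l r (by rintro rfl; simp at hl; omega) ?_ hr
    rw [hl]; simp
  · intro l₁ a b l₂ hIm hlen
    have hlen' := hlen
    simp only [List.length_append, List.length_cons] at hlen'
    rw [hgn _ hlen, hgn (l₁ ++ b :: a :: l₂) (by simp; omega)]
    have := hsym _ (hget _ hIm hlen)
      (Equiv.swap ⟨l₁.length, by omega⟩ ⟨l₁.length + 1, by omega⟩)
    rw [← this]
    congr 1
    funext i
    rcases i with ⟨i, hi⟩
    simp only [Function.comp]
    by_cases h1 : i = l₁.length
    · subst h1
      rw [Equiv.swap_apply_left]; simp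
    · by_cases h2 : i = l₁.length + 1
      · subst h2
        rw [Equiv.swap_apply_right]; simp
      · rw [Equiv.swap_apply_of_ne_of_ne (by simpa using h1) (by simpa using h2)]
        simp only [List.getD_eq_getElem?_getD]
        rcases lt_or_ge i l₁.length with h3 | h3
        · rw [List.getElem?_append_left h3, List.getElem?_append_left h3]
        · obtain ⟨j, rfl⟩ : ∃ j, i = l₁.length + (j + 2) := ⟨i - l₁.length - 2, by omega⟩
          rw [List.getElem?_append_right (by omega), List.getElem?_append_right (by omega)]
          simp

/-- Well-definedness of `S_x`: whether `(p-q)/k ∈ S_x` does not depend on the chosen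
representation: if `(p-q)/k = (p'-q')/k'` with `k, p, q+1, k', p', q'+1 ∈ Aₙ`, then
`g(c^p) > g(x^k c^q)` iff `g(c^{p'}) > g(x^{k'} c^{q'})`. -/
theorem stmt_14 (n : ℕ) (hn : 2 ≤ n) (I : Set ℝ) (hI : I.OrdConnected)
    (hne : ∃ a ∈ I, ∃ b ∈ I, a ≠ b)
    (f : (Fin n → ℝ) → ℝ)
    (hmap : ∀ x : Fin n → ℝ, (∀ i, x i ∈ I) → f x ∈ I)
    (hcont : ContinuousOn f {x | ∀ i, x i ∈ I})
    (hsym : SymmOn n I f) (hcanc : CancOn n I f) (hassoc : NAssocOn n I f)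
    (g : List ℝ → ℝ)
    -- g is the n-associative extension of f with g₁ = id:
    (hg1 : ∀ a : ℝ, g [a] = a)
    (hgn : ∀ l : List ℝ, l.length = n → g l = f (fun i : Fin n => l.getD (i : ℕ) 0))
    (hgrec : ∀ l r : List ℝ, l ≠ [] → l.length % (n - 1) = 1 % (n - 1) →
      r.length = n - 1 → g (l ++ r) = g (g l :: r))
    (c : ℝ) (hc : c ∈ I) (hcf : c < f (fun _ => c))
    :
    ∀ x ∈ I, ∀ k p q k' p' q' : ℕ,
      1 ≤ k → 1 ≤ p → k % (n - 1) = 1 % (n - 1) → p % (n - 1) = 1 % (n - 1) →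
      q % (n - 1) = 0 →
      1 ≤ k' → 1 ≤ p' → k' % (n - 1) = 1 % (n - 1) → p' % (n - 1) = 1 % (n - 1) →
      q' % (n - 1) = 0 →
      ((p : ℝ) - (q : ℝ)) / (k : ℝ) = ((p' : ℝ) - (q' : ℝ)) / (k' : ℝ) →
      (g (List.replicate p c) > g (List.replicate k x ++ List.replicate q c) ↔
        g (List.replicate p' c) > g (List.replicate k' x ++ List.replicate q' c)) := by
  have G := gprop_of n hn I hI hne f hmap hcont hsym hcanc hassoc g hg1 hgn hgrec
  intro x hx k p q k' p' q' hk1 hp1 hk hp hq hk1' hp1' hk' hp' hq' heq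
  obtain ⟨a, ha⟩ := exists_eq_of_mod hk1 hk
  obtain ⟨b, hb⟩ := exists_eq_of_mod hp1 hp
  obtain ⟨d, hd⟩ := Nat.dvd_of_mod_eq_zero hq
  obtain ⟨a', ha'⟩ := exists_eq_of_mod hk1' hk'
  obtain ⟨b', hb'⟩ := exists_eq_of_mod hp1' hp'
  obtain ⟨d', hd'⟩ := Nat.dvd_of_mod_eq_zero hq'
  have hkR : (k : ℝ) ≠ 0 := by exact_mod_cast (by omega : k ≠ 0)
  have hkR' : (k' : ℝ) ≠ 0 := by exact_mod_cast (by omega : k' ≠ 0)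
  rw [div_eq_div_iff hkR hkR'] at heq
  have heq' : p * k' + q' * k = p' * k + q * k' := by
    have : (p : ℝ) * k' + q' * k = p' * k + q * k' := by linarith
    exact_mod_cast this
  have := G.final hx hc k p q k' p' q' a b d a' b' d' ha hb hd ha' hb' hd' heq'
  simpa [xc] using this
end

section
/- In the setting of the Main Theorem's proof, for each x ∈ I the set S_x is a nonempty proper upper subset of S: there exists r ∈ S_x, there exists r' ∈ S \ S_x, and whenever r ∈ S_x and r' ∈ S with r' > r, one has r' ∈ S_x. -/
/-- The set `S_x`: rationals `(p-q)/k` with `k, p, q+1 ∈ Aₙ` such that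
`g(c^p) > g(x^k c^q)`. -/
def SxSet (n : ℕ) (g : List ℝ → ℝ) (c x : ℝ) : Set ℝ :=
  {r | ∃ k p q : ℕ, 1 ≤ k ∧ 1 ≤ p ∧
    k % (n - 1) = 1 % (n - 1) ∧ p % (n - 1) = 1 % (n - 1) ∧ q % (n - 1) = 0 ∧
    r = ((p : ℝ) - (q : ℝ)) / (k : ℝ) ∧
    g (List.replicate k x ++ List.replicate q c) < g (List.replicate p c)}

/-- The set `S = {(p-q)/k : k, p, q+1 ∈ Aₙ}`. -/
def Sset (n : ℕ) : Set ℝ :=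
  {r | ∃ k p q : ℕ, 1 ≤ k ∧ 1 ≤ p ∧
    k % (n - 1) = 1 % (n - 1) ∧ p % (n - 1) = 1 % (n - 1) ∧ q % (n - 1) = 0 ∧
    r = ((p : ℝ) - (q : ℝ)) / (k : ℝ)}

/-- Adjacent swaps generate all permutations. -/
lemma perm_of_adj (g : List ℝ → ℝ) (I : Set ℝ) (M : ℕ)
    (h : ∀ (l₁ l₂ : List ℝ) (a b : ℝ), (∀ y ∈ l₁ ++ a :: b :: l₂, y ∈ I) →
      (l₁ ++ a :: b :: l₂).length = M → g (l₁ ++ a :: b :: l₂) = g (l₁ ++ b :: a :: l₂))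
    {l l' : List ℝ} (hp : l.Perm l') :
    ∀ pre : List ℝ, (∀ y ∈ pre ++ l, y ∈ I) → (pre ++ l).length = M →
      g (pre ++ l) = g (pre ++ l') := by
  induction hp with
  | nil => intros; rfl
  | cons a _ ih =>
    intro pre h1 h2
    have := ih (pre ++ [a]) (by simpa using h1) (by simpa using h2)
    simpa using this
  | swap a b l =>
    intro pre h1 h2
    exact h pre l b a h1 h2
  | trans p1 p2 ih1 ih2 =>
    intro pre h1 h2
    rw [ih1 pre h1 h2]
    apply ih2
    · intro y hy
      exact h1 y (((p1.append_left pre).mem_iff).2 hy)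
    · rw [← (p1.append_left pre).length_eq]; exact h2

structure Setup (N : ℕ) (I : Set ℝ) (f : (Fin (N+1) → ℝ) → ℝ) (g : List ℝ → ℝ) : Prop where
  hN : 1 ≤ N
  hI : I.OrdConnected
  hmap : ∀ x : Fin (N+1) → ℝ, (∀ i, x i ∈ I) → f x ∈ I
  hcont : ContinuousOn f {x | ∀ i, x i ∈ I}
  hsym : SymmOn (N+1) I f
  hcanc : CancOn (N+1) I f
  hassoc : NAssocOn (N+1) I f
  hg1 : ∀ a : ℝ, g [a] = a
  hgn : ∀ l : List ℝ, l.length = N+1 → g l = f (fun i : Fin (N+1) => l.getD (i : ℕ) 0)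
  hgrec : ∀ (m : ℕ) (l r : List ℝ), l.length = 1 + m * N → r.length = N →
    g (l ++ r) = g (g l :: r)

namespace Setup

variable {N : ℕ} {I : Set ℝ} {f : (Fin (N+1) → ℝ) → ℝ} {g : List ℝ → ℝ}

lemma getD_mem {l : List ℝ} (h : ∀ y ∈ l, y ∈ I) {i : ℕ} (hi : i < l.length) :
    l.getD i 0 ∈ I := by
  rw [List.getD_eq_getElem _ _ hi]
  exact h _ (List.getElem_mem hi)

lemma mem (H : Setup N I f g) (m : ℕ) : ∀ l : List ℝ, l.length = 1 + m * N →
    (∀ y ∈ l, y ∈ I) → g l ∈ I := by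
  induction m with
  | zero =>
    intro l hl h
    obtain ⟨a, rfl⟩ := List.length_eq_one_iff.1 (by simpa using hl)
    rw [H.hg1]; exact h a (by simp)
  | succ m ih =>
    intro l hl h
    have e : (l.take (1 + m * N)) ++ (l.drop (1 + m * N)) = l := List.take_append_drop _ _
    have e1 : (l.take (1 + m * N)).length = 1 + m * N := by
      rw [List.length_take, hl]; simp [add_mul]
    have e2 : (l.drop (1 + m * N)).length = N := by
      rw [List.length_drop, hl, add_mul]; omega
    have h1 := ih _ e1 (fun y hy => h y (List.mem_of_mem_take hy))
    rw [← e, H.hgrec m _ _ e1 e2, H.hgn _ (by simp only [List.length_cons]; omega)]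
    apply H.hmap
    intro i
    apply getD_mem
    · intro y hy
      rcases List.mem_cons.1 hy with rfl | hy
      · exact h1
      · exact h y (List.mem_of_mem_drop hy)
    · have := i.2
      simp only [List.length_cons]; omega

lemma assoc (H : Setup N I f g) (m k : ℕ) : ∀ l r : List ℝ, l.length = 1 + m * N →
    r.length = k * N → g (l ++ r) = g (g l :: r) := by
  induction k with
  | zero =>
    intro l r hl hr
    have : r = [] := List.length_eq_zero_iff.1 (by simpa using hr)
    subst this
    simp [H.hg1]
  | succ k ih =>
    intro l r hl hr
    obtain ⟨r1, r2, rfl, h1, h2⟩ : ∃ r1 r2, r = r1 ++ r2 ∧ r1.length = k * N ∧ r2.length = N := by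
      refine ⟨r.take (k*N), r.drop (k*N), (List.take_append_drop _ _).symm, ?_, ?_⟩
      · rw [List.length_take, hr]; simp [add_mul]
      · rw [List.length_drop, hr, add_mul]; omega
    rw [← List.append_assoc, H.hgrec (m + k) _ _ (by simp [hl, h1]; ring) h2, ih _ _ hl h1,
      ← List.cons_append, H.hgrec k _ _ (by simp [h1]; ring) h2]

lemma swapN (H : Setup N I f g) (l₁ l₂ : List ℝ) (a b : ℝ)
    (h : ∀ y ∈ l₁ ++ a :: b :: l₂, y ∈ I) (hl : (l₁ ++ a :: b :: l₂).length = N + 1) :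
    g (l₁ ++ a :: b :: l₂) = g (l₁ ++ b :: a :: l₂) := by
  have hl' : (l₁ ++ b :: a :: l₂).length = N + 1 := by simpa using hl
  have hlen : l₁.length + 1 < N + 1 := by simp at hl; omega
  rw [H.hgn _ hl, H.hgn _ hl']
  have := H.hsym (fun i : Fin (N+1) => (l₁ ++ a :: b :: l₂).getD (i : ℕ) 0)
    (fun i => getD_mem h (by rw [hl]; exact i.2))
    (Equiv.swap ⟨l₁.length, by omega⟩ ⟨l₁.length + 1, hlen⟩)
  rw [← this]
  congr 1
  funext i
  simp only [Function.comp]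
  rcases lt_trichotomy (i : ℕ) l₁.length with h1 | h1 | h1
  · rw [Equiv.swap_apply_of_ne_of_ne]
    · rw [List.getD_append _ _ _ _ h1, List.getD_append _ _ _ _ h1]
    · intro e; rw [e] at h1; simp at h1
    · intro e; rw [e] at h1; simp at h1
  · have e : i = ⟨l₁.length, by omega⟩ := Fin.ext h1
    rw [e, Equiv.swap_apply_left]
    simp [List.getD_append_right]
  · by_cases h2 : (i : ℕ) = l₁.length + 1
    · have e : i = ⟨l₁.length + 1, by omega⟩ := Fin.ext h2
      rw [e, Equiv.swap_apply_right]
      simp [List.getD_append_right]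
    · rw [Equiv.swap_apply_of_ne_of_ne]
      · rw [List.getD_append_right _ _ _ _ h1.le, List.getD_append_right _ _ _ _ h1.le]
        obtain ⟨d, hd⟩ : ∃ d, (i : ℕ) - l₁.length = d + 2 := ⟨i - l₁.length - 2, by omega⟩
        rw [hd]; simp
      · intro e; rw [e] at h1; simp at h1
      · intro e; rw [e] at h2; simp at h2

lemma permN (H : Setup N I f g) {l l' : List ℝ} (hp : l.Perm l')
    (h : ∀ y ∈ l, y ∈ I) (hl : l.length = N + 1) : g l = g l' := by
  simpa using perm_of_adj g I (N+1) H.swapN hp [] (by simpa using h) (by simpa using hl)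

lemma assocN (H : Setup N I f g) (a b : ℝ) (s r : List ℝ) (ha : a ∈ I) (hb : b ∈ I)
    (hs : ∀ y ∈ s, y ∈ I) (hr : ∀ y ∈ r, y ∈ I) (ls : s.length = N) (lr : r.length + 1 = N) :
    g (g (a :: s) :: b :: r) = g (a :: g (s ++ [b]) :: r) := by
  have hN := H.hN
  set L : List ℝ := a :: s ++ b :: r with hL
  have hLlen : L.length = 2 * N + 1 := by simp [hL]; omega
  have hLm : ∀ y ∈ L, y ∈ I := by
    intro y hy
    simp only [hL, List.cons_append, List.mem_cons, List.mem_append] at hy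
    rcases hy with rfl | hy | rfl | hy
    · exact ha
    · exact hs _ hy
    · exact hb
    · exact hr _ hy
  have key := H.hassoc (fun j => L.getD j 0) (fun j hj => getD_mem hLm (by omega)) 0 (by omega)
  have hR : ∀ i, L.getD (N + 1 + i) 0 = (b :: r).getD i 0 := by
    intro i
    have e : N + 1 + i - (a :: s).length = i := by simp only [List.length_cons]; omega
    rw [hL, List.getD_append_right (a :: s) _ _ _ (by simp only [List.length_cons]; omega), e]
  have e1 : g (a :: s) = f (fun l : Fin (N+1) => L.getD (0 + (l : ℕ)) 0) := by
    rw [H.hgn _ (by simp [ls])]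
    congr 1; funext i
    rw [hL, List.getD_append _ _ _ _ (by have := i.2; simp only [List.length_cons]; omega)]; simp
  have e2 : g (s ++ [b]) = f (fun l : Fin (N+1) => L.getD (0 + 1 + (l : ℕ)) 0) := by
    rw [H.hgn _ (by simp [ls])]
    congr 1; funext i
    have hi := i.2
    have : L = [a] ++ ((s ++ [b]) ++ r) := by simp [hL]
    have e3 : 0 + 1 + (i : ℕ) - [a].length = i := by simp
    rw [this, List.getD_append_right [a] _ _ _ (by simp), e3,
      List.getD_append (s ++ [b]) r _ _ (by simp [ls]; omega)]
  rw [← e1, ← e2] at key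
  rw [H.hgn (g (a :: s) :: b :: r) (by simp [lr]), H.hgn (a :: g (s ++ [b]) :: r) (by simp [lr])]
  convert key using 2
  · funext i
    rcases i with ⟨i, hi⟩
    rcases i with _ | i
    · simp
    · have : i + 1 + (N + 1) - 1 = (N + 1) + i := by omega
      simp only [this]
      rw [hR]
      simp
  · funext i
    rcases i with ⟨i, hi⟩
    rcases i with _ | _ | i
    · simp [hL]
    · simp
    · have : i + 1 + 1 + (N + 1) - 1 = (N + 1) + (i + 1) := by omega
      simp only [this]
      rw [hR]
      simp

lemma exists_split (l : List ℝ) (a b : ℕ) (h : l.length = a + b) :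
    ∃ r1 r2, l = r1 ++ r2 ∧ r1.length = a ∧ r2.length = b := by
  refine ⟨l.take a, l.drop a, (List.take_append_drop _ _).symm, ?_, ?_⟩
  · rw [List.length_take, h]; simp
  · rw [List.length_drop, h]; omega

lemma perm (H : Setup N I f g) (m : ℕ) : ∀ {l l' : List ℝ}, l.Perm l' →
    (∀ y ∈ l, y ∈ I) → l.length = 1 + m * N → g l = g l' := by
  have hN := H.hN
  induction m with
  | zero =>
    intro l l' hp h hl
    obtain ⟨a, rfl⟩ := List.length_eq_one_iff.1 (by simpa using hl)
    rw [List.singleton_perm.1 hp]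
  | succ m ih =>
    intro l l' hp h hl
    suffices hadj : ∀ (l₁ l₂ : List ℝ) (a b : ℝ), (∀ y ∈ l₁ ++ a :: b :: l₂, y ∈ I) →
        (l₁ ++ a :: b :: l₂).length = 1 + (m+1) * N →
        g (l₁ ++ a :: b :: l₂) = g (l₁ ++ b :: a :: l₂) by
      exact perm_of_adj g I (1 + (m+1) * N) hadj hp [] h hl
    clear hp h hl
    intro l₁ l₂ a b h hl
    have hl0 := hl
    rcases m with _ | m
    · exact H.swapN _ _ _ _ h (by rw [hl]; ring)
    have hl3 : l₁.length + l₂.length + 2 = 1 + (m + 1 + 1) * N := by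
      rw [← hl]; simp; ring
    have ha : a ∈ I := h a (by simp)
    have hb : b ∈ I := h b (by simp)
    have h1 : ∀ y ∈ l₁, y ∈ I := fun y hy => h y (by simp [hy])
    have h2 : ∀ y ∈ l₂, y ∈ I := fun y hy => h y (by simp [hy])
    have x1 : (m + 1 + 1) * N = m * N + N + N := by ring
    have x2 : (m + 1) * N = m * N + N := by ring
    rcases lt_trichotomy (l₂.length + 1) N with hc | hc | hc
    · obtain ⟨L, r, rfl, hL, hr⟩ := exists_split l₁ (1 + (m+1) * N) (N - 2 - l₂.length) (by omega)
      have hgL := H.mem (m+1) L hL (fun y hy => h1 y (by simp [hy]))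
      rw [List.append_assoc, List.append_assoc, H.hgrec (m+1) L _ hL (by simp; omega),
        H.hgrec (m+1) L _ hL (by simp; omega)]
      have := H.swapN (g L :: r) l₂ a b (by
        intro y hy
        simp only [List.cons_append, List.mem_cons, List.mem_append] at hy
        rcases hy with rfl | hy | rfl | rfl | hy
        · exact hgL
        · exact h1 _ (by simp [hy])
        · exact ha
        · exact hb
        · exact h2 _ hy) (by simp; omega)
      simpa using this
    · obtain ⟨L, s, rfl, hL, hs⟩ := exists_split l₁ (1 + m * N) (N - 1) (by omega)
      have hgL := H.mem m L hL (fun y hy => h1 y (by simp [hy]))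
      have hsI : ∀ y ∈ s, y ∈ I := fun y hy => h1 y (by simp [hy])
      have main : ∀ a b, a ∈ I → b ∈ I → g ((L ++ s) ++ a :: b :: l₂)
          = g (g L :: g (s ++ [a] ++ [b]) :: l₂) := by
        intro a b ha hb
        have : (L ++ s) ++ a :: b :: l₂ = (L ++ (s ++ [a])) ++ b :: l₂ := by simp
        rw [this, H.hgrec (m+1) _ _ (by simp; omega) (by simp; omega),
          H.hgrec m L _ hL (by simp; omega)]
        apply H.assocN _ _ _ _ hgL hb _ h2 (by simp; omega) hc
        intro y hy
        simp only [List.mem_append, List.mem_singleton] at hy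
        rcases hy with hy | rfl
        · exact hsI _ hy
        · exact ha
      rw [main a b ha hb, main b a hb ha]
      have := H.swapN s [] a b (by
        intro y hy
        simp only [List.mem_cons, List.mem_append] at hy
        rcases hy with hy | rfl | rfl | hy
        · exact hsI _ hy
        · exact ha
        · exact hb
        · simp at hy) (by simp; omega)
      have e : g (s ++ [a] ++ [b]) = g (s ++ [b] ++ [a]) := by simpa using this
      rw [e]
    · obtain ⟨L, r, rfl, hL, hr⟩ := exists_split l₂ (l₂.length - N) N (by omega)
      simp only [List.length_append] at hl3 hL hc
      have e1 : ∀ a b, l₁ ++ a :: b :: (L ++ r) = (l₁ ++ a :: b :: L) ++ r := by simp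
      rw [e1, e1, H.hgrec (m+1) _ _ (by simp; omega) hr, H.hgrec (m+1) _ _ (by simp; omega) hr]
      have : g (l₁ ++ a :: b :: L) = g (l₁ ++ b :: a :: L) := by
        apply ih
        · exact (List.Perm.swap b a L).append_left l₁
        · intro y hy
          apply h
          simp only [List.mem_cons, List.mem_append] at hy ⊢
          tauto
        · simp; omega
      rw [this]

lemma injN (H : Setup N I f g) (w : List ℝ) (hw : ∀ y ∈ w, y ∈ I) (lw : w.length = N) :
    Set.InjOn (fun t => g (t :: w)) I := by
  intro t ht t' ht' e
  simp only at e
  rw [H.hgn _ (by simp [lw]), H.hgn _ (by simp [lw])] at e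
  have := H.hcanc 0 _ _ ?_ ?_ ?_ e
  · simpa using this
  · intro i
    exact getD_mem (by simpa [ht] using hw) (by have := i.2; simp only [List.length_cons]; omega)
  · intro i
    exact getD_mem (by simpa [ht'] using hw) (by have := i.2; simp only [List.length_cons]; omega)
  · intro i hi
    obtain ⟨j, rfl⟩ := Fin.exists_succ_eq.2 hi
    simp

lemma contN (H : Setup N I f g) (w : List ℝ) (hw : ∀ y ∈ w, y ∈ I) (lw : w.length = N) :
    ContinuousOn (fun t => g (t :: w)) I := by
  have : (fun t => g (t :: w)) = f ∘ (fun t => fun i : Fin (N+1) => (t :: w).getD (i : ℕ) 0) := by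
    funext t
    rw [H.hgn _ (by simp [lw])]; rfl
  rw [this]
  apply H.hcont.comp
  · apply Continuous.continuousOn
    apply continuous_pi
    intro i
    refine Fin.cases ?_ (fun j => ?_) i
    · simpa using continuous_id'
    · simpa using continuous_const
  · intro t ht i
    exact getD_mem (by simpa [ht] using hw) (by have := i.2; simp only [List.length_cons]; omega)

lemma strictN (H : Setup N I f g) (hne : ∃ a ∈ I, ∃ b ∈ I, a ≠ b)
    (w : List ℝ) (hw : ∀ y ∈ w, y ∈ I) (lw : w.length = N) :
    StrictMonoOn (fun t => g (t :: w)) I := by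
  have hinj := H.injN w hw lw
  have hct := H.contN w hw lw
  have hmp : ∀ t ∈ I, g (t :: w) ∈ I := fun t ht =>
    H.mem 1 _ (by simp [lw]; ring) (by simpa [ht] using hw)
  obtain ⟨a, ha, b, hb, hab⟩ := hne
  have hdich : StrictMonoOn (fun t => g (t :: w)) I ∨ StrictAntiOn (fun t => g (t :: w)) I := by
    haveI := H.hI
    letI : Inhabited I := ⟨⟨a, ha⟩⟩
    have := Continuous.strictMono_of_inj (f := Set.domRestrict I (fun t => g (t :: w)))
      hct.domRestrict hinj.injective
    refine this.imp (fun h u hu v hv huv => ?_) (fun h u hu v hv huv => ?_)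
    · exact h (a := ⟨u, hu⟩) (b := ⟨v, hv⟩) huv
    · exact h (a := ⟨u, hu⟩) (b := ⟨v, hv⟩) huv
  rcases hdich with h | h
  · exact h
  exfalso
  -- fixed point
  obtain ⟨e, he, hfe⟩ : ∃ e ∈ I, g (e :: w) = e := by
    have hpre : IsPreconnected I := Set.OrdConnected.isPreconnected H.hI
    have hb' := hmp a ha
    rcases lt_trichotomy a (g (a :: w)) with h1 | h1 | h1
    · have h2 := h ha hb' h1
      simp only at h2
      obtain ⟨e, he, h3⟩ := hpre.intermediate_value₂ ha hb' continuousOn_id hct h1.le h2.le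
      exact ⟨e, he, h3.symm⟩
    · exact ⟨a, ha, h1.symm⟩
    · have h2 := h hb' ha h1
      simp only at h2
      obtain ⟨e, he, h3⟩ := hpre.intermediate_value₂ hb' ha continuousOn_id hct h2.le h1.le
      exact ⟨e, he, h3.symm⟩
  have hN := H.hN
  have hid : ∀ y ∈ I, g (y :: w) = y := by
    intro y hy
    set u := List.replicate (N-1) e with hu
    have huI : ∀ z ∈ u, z ∈ I := by
      intro z hz; rw [List.eq_of_mem_replicate hz]; exact he
    have hul : u.length = N - 1 := by simp [hu]
    have heu : ∀ z ∈ e :: u, z ∈ I := by simpa [he] using huI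
    apply H.injN (e :: u) heu (by simp [hul]; omega) (hmp y hy) hy
    simp only
    rw [← H.hgrec 1 (y :: w) (e :: u) (by simp [lw]; ring) (by simp [hul]; omega)]
    have hall : ∀ z ∈ y :: w ++ e :: u, z ∈ I := by
      intro z hz
      simp only [List.cons_append, List.mem_cons, List.mem_append] at hz
      rcases hz with rfl | hz | rfl | hz
      · exact hy
      · exact hw _ hz
      · exact he
      · exact huI _ hz
    have p1 : (y :: w ++ e :: u).Perm ((e :: w) ++ y :: u) := by
      rw [← Multiset.coe_eq_coe]
      simp only [← Multiset.coe_add, ← Multiset.cons_coe, ← Multiset.singleton_add]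
      abel
    rw [H.perm 2 p1 hall (by simp [lw, hul]; omega),
      H.hgrec 1 (e :: w) (y :: u) (by simp [lw]; ring) (by simp [hul]; omega), hfe]
    apply H.permN (List.Perm.swap y e u)
    · simpa [he, hy] using huI
    · simp [hul]; omega
  rcases lt_or_gt_of_ne hab with h1 | h1
  · have := h ha hb h1
    simp only [hid a ha, hid b hb] at this
    linarith
  · have := h hb ha h1
    simp only [hid a ha, hid b hb] at this
    linarith

lemma strict (H : Setup N I f g) (hne : ∃ a ∈ I, ∃ b ∈ I, a ≠ b) (k : ℕ) :
    ∀ w : List ℝ, (∀ y ∈ w, y ∈ I) → w.length = k * N →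
    StrictMonoOn (fun t => g (t :: w)) I := by
  induction k with
  | zero =>
    intro w hw lw
    have : w = [] := List.length_eq_zero_iff.1 (by simpa using lw)
    subst this
    intro a _ b _ hab
    simpa [H.hg1] using hab
  | succ k ih =>
    intro w hw lw
    obtain ⟨w1, w2, rfl, h1, h2⟩ := exists_split w (k * N) N (by rw [lw]; ring)
    have hw1 : ∀ y ∈ w1, y ∈ I := fun y hy => hw y (by simp [hy])
    have hw2 : ∀ y ∈ w2, y ∈ I := fun y hy => hw y (by simp [hy])
    intro a ha b hb hab
    simp only
    rw [← List.cons_append, ← List.cons_append, H.hgrec k _ _ (by simp [h1]; ring) h2,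
      H.hgrec k _ _ (by simp [h1]; ring) h2]
    apply H.strictN hne w2 hw2 h2
    · exact H.mem k _ (by simp [h1]; ring) (by simpa [ha] using hw1)
    · exact H.mem k _ (by simp [h1]; ring) (by simpa [hb] using hw1)
    · exact ih w1 hw1 h1 ha hb hab

lemma two_mem {x c : ℝ} (hx : x ∈ I) (hc : c ∈ I) (a b : ℕ) :
    ∀ y ∈ List.replicate a x ++ List.replicate b c, y ∈ I := by
  intro y hy
  rcases List.mem_append.1 hy with h | h
  · rw [List.eq_of_mem_replicate h]; exact hx
  · rw [List.eq_of_mem_replicate h]; exact hc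

lemma shift (H : Setup N I f g) (hne : ∃ a ∈ I, ∃ b ∈ I, a ≠ b) {x c : ℝ} (hx : x ∈ I)
    (hc : c ∈ I) (a b a' b' s t i j k : ℕ) (h1 : a + b = 1 + i * N) (h2 : a' + b' = 1 + j * N)
    (h3 : s + t = k * N) :
    g (List.replicate a x ++ List.replicate b c) < g (List.replicate a' x ++ List.replicate b' c) ↔
    g (List.replicate (a + s) x ++ List.replicate (b + t) c)
      < g (List.replicate (a' + s) x ++ List.replicate (b' + t) c) := by
  have key : ∀ a b i, a + b = 1 + i * N → g (List.replicate (a + s) x ++ List.replicate (b + t) c)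
      = g (g (List.replicate a x ++ List.replicate b c) ::
        (List.replicate s x ++ List.replicate t c)) := by
    intro a b i h
    rw [← H.assoc i k _ _ (by simp [h]) (by simp [h3])]
    apply H.perm (i + k) _ (two_mem hx hc _ _)
    · simp only [List.length_append, List.length_replicate]
      rw [add_mul]; omega
    · rw [← Multiset.coe_eq_coe]
      simp only [← Multiset.coe_add, List.replicate_add]
      abel
  rw [key a b i h1, key a' b' j h2]
  exact ((H.strict hne k _ (two_mem hx hc s t) (by simp [h3])).lt_iff_lt
    (H.mem i _ (by simp [h1]) (two_mem hx hc _ _))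
    (H.mem j _ (by simp [h2]) (two_mem hx hc _ _))).symm

/-- adding `N` copies of `c` increases the value -/
lemma lt_psi (H : Setup N I f g) (hne : ∃ a ∈ I, ∃ b ∈ I, a ≠ b) {c : ℝ}
    (hc : c ∈ I) (hcf : c < f (fun _ => c)) {y : ℝ} (hy : y ∈ I) :
    y < g (y :: List.replicate N c) := by
  have hN := H.hN
  have hfc : g (List.replicate (N+1) c) = f (fun _ => c) := by
    rw [H.hgn _ (by simp)]
    congr 1; funext i
    rw [List.getD_eq_getElem _ _ (by have := i.2; simp only [List.length_replicate]; omega)]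
    simp
  have hrI : ∀ k, ∀ z ∈ List.replicate k c, z ∈ I := by
    intro k z hz; rw [List.eq_of_mem_replicate hz]; exact hc
  have hS := H.strictN hne (List.replicate N c) (hrI N) (by simp)
  have hyI : ∀ k, ∀ z ∈ y :: List.replicate k c, z ∈ I := by
    intro k z hz
    rcases List.mem_cons.1 hz with rfl | hz
    · exact hy
    · exact hrI _ _ hz
  have hgy : g (y :: List.replicate N c) ∈ I := H.mem 1 _ (by simp; ring) (hyI N)
  rw [← hS.lt_iff_lt hy hgy]
  rw [← H.hgrec 1 _ _ (by simp; ring) (by simp)]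
  obtain ⟨M, rfl⟩ : ∃ M, N = M + 1 := ⟨N - 1, by omega⟩
  have p1 : (y :: List.replicate (M+1) c ++ List.replicate (M+1) c).Perm
      (List.replicate (M+1+1) c ++ y :: List.replicate M c) := by
    rw [← Multiset.coe_eq_coe]
    simp only [← Multiset.coe_add, ← Multiset.cons_coe, ← Multiset.singleton_add,
      List.replicate_succ]
    abel
  rw [H.perm 2 p1 (by
      intro z hz
      rcases List.mem_append.1 hz with h | h
      · exact hyI _ _ h
      · exact hrI _ _ h) (by simp; ring),
    H.hgrec 1 _ _ (by simp; ring) (by simp), hfc]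
  have e : g (y :: List.replicate (M+1) c) = g (c :: y :: List.replicate M c) := by
    apply H.permN _ (hyI _) (by simp)
    rw [List.replicate_succ]
    exact List.Perm.swap _ _ _
  rw [e]
  exact H.strictN hne (y :: List.replicate M c) (hyI M) (by simp) hc
    (H.hmap _ (fun _ => hc)) hcf

lemma step (H : Setup N I f g) (y c : ℝ) (j : ℕ) : g (y :: List.replicate ((j+1) * N) c)
    = g (g (y :: List.replicate (j * N) c) :: List.replicate N c) := by
  rw [← H.hgrec j _ _ (by simp; ring) (by simp)]
  rw [add_mul, one_mul, List.replicate_add, List.cons_append]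

lemma seq_mem (H : Setup N I f g) {y c : ℝ} (hy : y ∈ I) (hc : c ∈ I) (j : ℕ) :
    g (y :: List.replicate (j * N) c) ∈ I := by
  apply H.mem j _ (by simp; ring)
  intro z hz
  rcases List.mem_cons.1 hz with rfl | hz
  · exact hy
  · rw [List.eq_of_mem_replicate hz]; exact hc

lemma seq_mono (H : Setup N I f g) (hne : ∃ a ∈ I, ∃ b ∈ I, a ≠ b) {c : ℝ}
    (hc : c ∈ I) (hcf : c < f (fun _ => c)) {y : ℝ} (hy : y ∈ I) :
    Monotone (fun j : ℕ => g (y :: List.replicate (j * N) c)) := by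
  apply monotone_nat_of_le_succ
  intro j
  rw [H.step]
  exact (H.lt_psi hne hc hcf (H.seq_mem hy hc j)).le

lemma arch (H : Setup N I f g) (hne : ∃ a ∈ I, ∃ b ∈ I, a ≠ b) {c : ℝ}
    (hc : c ∈ I) (hcf : c < f (fun _ => c)) {y z : ℝ} (hy : y ∈ I) (hz : z ∈ I) :
    ∃ j : ℕ, z < g (y :: List.replicate (j * N) c) := by
  by_contra! hcon
  have hmono := H.seq_mono hne hc hcf hy
  set s : ℕ → ℝ := fun j : ℕ => g (y :: List.replicate (j * N) c) with hs
  have hbdd : BddAbove (Set.range s) := ⟨z, by rintro _ ⟨j, rfl⟩; exact hcon j⟩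
  have hlim := tendsto_atTop_ciSup hmono hbdd
  set L := ⨆ i, s i with hLdef
  have hL : L ∈ I := by
    apply H.hI.out hy hz
    constructor
    · have := le_ciSup hbdd 0
      simpa [hs, H.hg1] using this
    · exact ciSup_le hcon
  have hct := H.contN (List.replicate N c)
    (by intro z hz; rw [List.eq_of_mem_replicate hz]; exact hc) (by simp) L hL
  have hlim2 : Filter.Tendsto s Filter.atTop (nhdsWithin L I) :=
    tendsto_nhdsWithin_iff.2 ⟨hlim, Filter.Eventually.of_forall (fun j => H.seq_mem hy hc j)⟩
  have h3 := hct.tendsto.comp hlim2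
  have h4 : Filter.Tendsto (fun j => s (j+1)) Filter.atTop (nhds L) :=
    hlim.comp (Filter.tendsto_add_atTop_nat 1)
  have h5 : (fun t => g (t :: List.replicate N c)) ∘ s = fun j => s (j+1) := by
    funext j
    exact (H.step y c j).symm
  rw [h5] at h3
  have h6 := tendsto_nhds_unique h4 h3
  have h7 := H.lt_psi hne hc hcf hL
  linarith

end Setup

lemma pow_lt (N : ℕ) (G : ℕ → ℕ → ℝ) (R : ℝ → ℝ → Prop) (htr : ∀ a b c, R a b → R b c → R a c)
    (hsh : ∀ a b a' b' s t i j k : ℕ, a + b = 1 + i * N → a' + b' = 1 + j * N → s + t = k * N →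
      R (G a b) (G a' b') → R (G (a + s) (b + t)) (G (a' + s) (b' + t)))
    (a b a' b' i j : ℕ) (h1 : a + b = 1 + i * N) (h2 : a' + b' = 1 + j * N)
    (h : R (G a b) (G a' b')) (m : ℕ) : ∀ s t k, s + t + (m + 1) = 1 + k * N →
      R (G ((m+1) * a + s) ((m+1) * b + t)) (G ((m+1) * a' + s) ((m+1) * b' + t)) := by
  induction m with
  | zero =>
    intro s t k hk
    simpa using hsh a b a' b' s t i j k h1 h2 (by omega) h
  | succ m ih =>
    intro s t k hk
    have A := ih (s + a) (t + b) (k + i) (by rw [add_mul]; omega)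
    have B := hsh a b a' b' ((m+1) * a' + s) ((m+1) * b' + t) i j (k + (m+1) * j) h1 h2 (by
      have : (m+1) * a' + s + ((m+1) * b' + t) = (m+1) * (a' + b') + s + t := by ring
      rw [this, h2]
      have e : (m+1) * (1 + j * N) = (m + 1) + (m+1) * j * N := by ring
      rw [e, add_mul k]; omega) h
    have e1 : (m+1+1) * a + s = (m+1) * a + (s + a) := by ring
    have e2 : (m+1+1) * b + t = (m+1) * b + (t + b) := by ring
    have e3 : (m+1+1) * a' + s = a' + ((m+1) * a' + s) := by ring
    have e4 : (m+1+1) * b' + t = b' + ((m+1) * b' + t) := by ring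
    have e5 : (m+1) * a' + (s + a) = a + ((m+1) * a' + s) := by ring
    have e6 : (m+1) * b' + (t + b) = b + ((m+1) * b' + t) := by ring
    rw [e5, e6] at A
    rw [e1, e2, e3, e4]
    exact htr _ _ _ A B

lemma exists_one_add (N k : ℕ) (h1 : 1 ≤ k) (h : k % N = 1 % N) : ∃ i, k = 1 + i * N := by
  have : N ∣ k - 1 := (Nat.modEq_iff_dvd' h1).1 (Eq.symm h)
  obtain ⟨i, hi⟩ := this
  exact ⟨i, by rw [mul_comm]; omega⟩

/-- Comparison of two representations. -/
lemma compare (N : ℕ) (G : ℕ → ℕ → ℝ)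
    (hsh : ∀ a b a' b' s t i j k : ℕ, a + b = 1 + i * N → a' + b' = 1 + j * N → s + t = k * N →
      (G a b < G a' b' ↔ G (a + s) (b + t) < G (a' + s) (b' + t)))
    (hmono : Monotone (fun j : ℕ => G 0 (1 + j * N)))
    (k p q k' p' q' : ℕ) (hk1 : 1 ≤ k) (hp1 : 1 ≤ p) (hk : k % N = 1 % N) (hp : p % N = 1 % N)
    (hq : q % N = 0) (hk1' : 1 ≤ k') (hp1' : 1 ≤ p') (hk' : k' % N = 1 % N)
    (hp' : p' % N = 1 % N) (hq' : q' % N = 0)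
    (h : G k q < G 0 p) (h' : G 0 p' ≤ G k' q') :
    ((p' : ℝ) - q') / k' < ((p : ℝ) - q) / k := by
  obtain ⟨ik, hik⟩ := exists_one_add N k hk1 hk
  obtain ⟨ip, hip⟩ := exists_one_add N p hp1 hp
  obtain ⟨ik', hik'⟩ := exists_one_add N k' hk1' hk'
  obtain ⟨ip', hip'⟩ := exists_one_add N p' hp1' hp'
  obtain ⟨iq, hiq⟩ : ∃ i, q = i * N := by
    obtain ⟨i, hi⟩ := Nat.dvd_of_mod_eq_zero hq
    exact ⟨i, by rw [hi, mul_comm]⟩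
  obtain ⟨iq', hiq'⟩ : ∃ i, q' = i * N := by
    obtain ⟨i, hi⟩ := Nat.dvd_of_mod_eq_zero hq'
    exact ⟨i, by rw [hi, mul_comm]⟩
  obtain ⟨m, hm⟩ : ∃ m, k = m + 1 := ⟨k - 1, by omega⟩
  obtain ⟨m', hm'⟩ : ∃ m, k' = m + 1 := ⟨k' - 1, by omega⟩
  have A := pow_lt N G (· < ·) (fun _ _ _ => lt_trans)
    (fun a b a' b' s t i j k h1 h2 h3 h4 => (hsh a b a' b' s t i j k h1 h2 h3).1 h4)
    k q 0 p (ik + iq) ip (by rw [add_mul]; omega) (by omega) h m' 0 0 ik' (by omega)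
  have B := pow_lt N G (· ≤ ·) (fun _ _ _ => le_trans)
    (fun a b a' b' s t i j k h1 h2 h3 h4 => not_lt.1 (fun h5 => not_lt.2 h4
      ((hsh a' b' a b s t j i k h2 h1 h3).2 h5)))
    0 p' k' q' ip' (ik' + iq') (by omega) (by rw [add_mul]; omega) h' m 0 0 ik (by omega)
  rw [← hm'] at A
  rw [← hm] at B
  simp only [mul_zero, add_zero] at A B
  have A2 := (hsh (k' * k) (k' * q) 0 (k' * p) 0 (k * q')
    (ik' + ik + ik' * ik * N + k' * iq) (ik' + ip + ik' * ip * N) (k * iq')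
    (by rw [hiq, hik, hik']; ring) (by rw [hip, hik']; ring) (by rw [hiq']; ring)).1 A
  have B2 := not_lt.1 (fun h5 => not_lt.2 B ((hsh (k * k') (k * q') 0 (k * p') 0 (k' * q)
    (ik' + ik + ik' * ik * N + k * iq') (ik + ip' + ik * ip' * N) (k' * iq)
    (by rw [hiq', hik, hik']; ring) (by rw [hip', hik]; ring) (by rw [hiq]; ring)).2 h5))
  have e1 : k' * k = k * k' := mul_comm _ _
  have e2 : k' * q + k * q' = k * q' + k' * q := add_comm _ _
  rw [e1, e2] at A2
  simp only [add_zero] at A2 B2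
  have C := lt_of_le_of_lt B2 A2
  have e3 : k * p' + k' * q = 1 + (ik + ip' + ik * ip' * N + k' * iq) * N := by
    rw [hiq, hip', hik]; ring
  have e4 : k' * p + k * q' = 1 + (ik' + ip + ik' * ip * N + k * iq') * N := by
    rw [hiq', hip, hik']; ring
  have D : k * p' + k' * q < k' * p + k * q' := by
    rw [e3, e4] at C ⊢
    have := hmono.reflect_lt C
    have hN : 0 < N := by
      rcases Nat.eq_zero_or_pos N with h0 | h0
      · subst h0; simp at C
      · exact h0
    have := Nat.mul_lt_mul_of_pos_right this hN
    omega
  have D' : (k : ℝ) * p' + k' * q < k' * p + k * q' := by exact_mod_cast D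
  have hkp : (0 : ℝ) < k := by exact_mod_cast hk1
  have hkp' : (0 : ℝ) < k' := by exact_mod_cast hk1'
  rw [div_lt_div_iff₀ hkp' hkp]
  nlinarith

/-- Claim 7: for each `x ∈ I`, the set `S_x` is a nonempty, proper, upper subset of
`S`. -/
theorem stmt_15 (n : ℕ) (hn : 2 ≤ n) (I : Set ℝ) (hI : I.OrdConnected)
    (hne : ∃ a ∈ I, ∃ b ∈ I, a ≠ b)
    (f : (Fin n → ℝ) → ℝ)
    (hmap : ∀ x : Fin n → ℝ, (∀ i, x i ∈ I) → f x ∈ I)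
    (hcont : ContinuousOn f {x | ∀ i, x i ∈ I})
    (hsym : SymmOn n I f) (hcanc : CancOn n I f) (hassoc : NAssocOn n I f)
    (g : List ℝ → ℝ)
    -- g is the n-associative extension of f with g₁ = id:
    (hg1 : ∀ a : ℝ, g [a] = a)
    (hgn : ∀ l : List ℝ, l.length = n → g l = f (fun i : Fin n => l.getD (i : ℕ) 0))
    (hgrec : ∀ l r : List ℝ, l ≠ [] → l.length % (n - 1) = 1 % (n - 1) →
      r.length = n - 1 → g (l ++ r) = g (g l :: r))
    (c : ℝ) (hc : c ∈ I) (hcf : c < f (fun _ => c))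
    :
    ∀ x ∈ I,
      (∃ r, r ∈ SxSet n g c x) ∧
      (∃ r' ∈ Sset n, r' ∉ SxSet n g c x) ∧
      (∀ r ∈ SxSet n g c x, ∀ r' ∈ Sset n, r < r' → r' ∈ SxSet n g c x) := by
  obtain ⟨N, rfl⟩ : ∃ N, n = N + 1 := ⟨n - 1, by omega⟩
  have H : Setup N I f g := {
    hN := by omega
    hI := hI
    hmap := hmap
    hcont := hcont
    hsym := hsym
    hcanc := hcanc
    hassoc := hassoc
    hg1 := hg1
    hgn := hgn
    hgrec := by
      intro m l r hl hr
      apply hgrec l r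
      · rintro rfl; simp at hl; omega
      · rw [hl]; simp
      · simpa using hr }
  intro x hx
  have hsh := H.shift hne hx hc
  have hmono : Monotone (fun j : ℕ =>
      g (List.replicate 0 x ++ List.replicate (1 + j * N) c)) := by
    have := H.seq_mono hne hc hcf hc
    simpa [List.replicate_add] using this
  have cmp := compare N (fun a b => g (List.replicate a x ++ List.replicate b c)) hsh hmono
  simp only [SxSet, Sset, Nat.add_sub_cancel, Set.mem_ofPred_eq]
  refine ⟨?_, ?_, ?_⟩
  · obtain ⟨j, hj⟩ := H.arch hne hc hcf hc hx
    refine ⟨_, 1, 1 + j * N, 0, le_rfl, by omega, rfl, by simp, by simp, rfl, ?_⟩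
    simpa [hg1, List.replicate_add] using hj
  · obtain ⟨j, hj⟩ := H.arch hne hc hcf hx hc
    refine ⟨_, ⟨1, 1, j * N, le_rfl, le_rfl, rfl, rfl, by simp, rfl⟩, ?_⟩
    rintro ⟨k, p, q, hk1, hp1, hk, hp, hq, hr, hlt⟩
    have := cmp k p q 1 1 (j * N) hk1 hp1 hk hp hq le_rfl le_rfl rfl rfl (by simp)
      (by simpa using hlt) (by simpa [hg1] using hj.le)
    linarith
  · rintro r ⟨k, p, q, hk1, hp1, hk, hp, hq, hr, hlt⟩ r' ⟨k', p', q', hk1', hp1', hk', hp', hq', hr'⟩ hrr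
    refine ⟨k', p', q', hk1', hp1', hk', hp', hq', hr', ?_⟩
    by_contra! hcon
    have := cmp k p q k' p' q' hk1 hp1 hk hp hq hk1' hp1' hk' hp' hq'
      (by simpa using hlt) (by simpa using hcon)
    rw [← hr, ← hr'] at this
    linarith
end

section
/- In the setting of the Main Theorem's proof, define φ(x) = inf S_x. Then φ(g(x₁⋯xₙ)) = Σᵢ₌₁ⁿ φ(xᵢ) for all x₁,…,xₙ ∈ I; in particular φ is an n-ary semigroup homomorphism from (I, f) to (ℝ, +). -/
structure Core {α : Type*} [LinearOrder α] (m : ℕ) (G : Multiset α → α) (c : α) : Prop where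
  hm : 1 ≤ m
  sing : ∀ a, G {a} = a
  asc : ∀ A B : Multiset α, A ≠ 0 → A.card ≡ 1 [MOD m] → B.card ≡ 0 [MOD m] →
    G (A + B) = G (G A ::ₘ B)
  mono : ∀ (a b : α) (R : Multiset α), a < b → R.card ≡ 0 [MOD m] → G (a ::ₘ R) < G (b ::ₘ R)
  cinc : c < G ((m + 1) • {c})

namespace Core

variable {α : Type*} [LinearOrder α] {m : ℕ} {G : Multiset α → α} {c : α}

lemma modEq_mul (m j : ℕ) : j * m ≡ 0 [MOD m] := by
  simp [Nat.ModEq]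

lemma modEq_one (m j : ℕ) : 1 + j * m ≡ 1 [MOD m] := by
  simp [Nat.ModEq]

lemma mono_le (h : Core m G c) (a b : α) (R : Multiset α) (hab : a ≤ b)
    (hR : R.card ≡ 0 [MOD m]) : G (a ::ₘ R) ≤ G (b ::ₘ R) := by
  rcases hab.eq_or_lt with rfl | hlt
  · exact le_rfl
  · exact (h.mono a b R hlt hR).le

lemma inc (h : Core m G c) (x : α) : x < G (x ::ₘ m • {c}) := by
  by_contra hcon
  push Not at hcon
  obtain ⟨k, rfl⟩ : ∃ k, m = k + 1 := ⟨m - 1, by have := h.hm; omega⟩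
  have e1 := h.mono_le _ _ (c ::ₘ k • {x}) hcon (by simp [Nat.ModEq])
  rw [← h.asc _ _ (by simp) (by simp [Nat.ModEq]) (by simp [Nat.ModEq])] at e1
  have e2 := h.mono _ _ ((k + 1) • {x}) h.cinc (by simp [Nat.ModEq])
  rw [← h.asc _ _ (by simp) (by simp [Nat.ModEq]) (by simp [Nat.ModEq])] at e2
  have e3 : (x ::ₘ (k + 1) • {c} + c ::ₘ k • {x} : Multiset α)
      = (k + 1 + 1) • {c} + (k + 1) • {x} := by
    simp only [← Multiset.singleton_add, add_smul, one_smul]; abel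
  have e4 : (x ::ₘ c ::ₘ k • {x} : Multiset α) = c ::ₘ (k + 1) • {x} := by
    simp only [← Multiset.singleton_add, add_smul, one_smul]; abel
  rw [e3, e4] at e1
  exact absurd e1 (not_le.mpr e2)

lemma incA (h : Core m G c) (A : Multiset α) (hA : A ≠ 0) (hc : A.card ≡ 1 [MOD m]) :
    StrictMono (fun t : ℕ => G (A + (t * m) • {c})) := by
  apply strictMono_nat_of_lt_succ
  intro t
  have := h.inc (G (A + (t * m) • {c}))
  rw [← h.asc _ _ (by simp [hA]) (by simpa [Nat.ModEq] using hc) (by simp [Nat.ModEq])] at this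
  convert this using 2
  rw [add_assoc, ← add_smul]; ring_nf

def Le (m : ℕ) (G : Multiset α → α) (A B : Multiset α) : Prop :=
  A.card ≡ B.card [MOD m] ∧ ∀ R : Multiset α, R ≠ 0 → (A + R).card ≡ 1 [MOD m] →
    G (A + R) ≤ G (B + R)

lemma Le.refl (A : Multiset α) : Le m G A A := ⟨rfl, fun _ _ _ => le_rfl⟩

lemma Le.trans {A B C : Multiset α} (h1 : Le m G A B) (h2 : Le m G B C) : Le m G A C :=
  ⟨h1.1.trans h2.1, fun R hR hc => (h1.2 R hR hc).trans (h2.2 R hR (by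
    rw [Multiset.card_add] at hc ⊢
    exact (h1.1.symm.add_right _).trans hc))⟩

lemma Le.add_right {A B : Multiset α} (h1 : Le m G A B) (C : Multiset α) :
    Le m G (A + C) (B + C) :=
  ⟨by simpa using h1.1.add_right _, fun R hR hc => by
    rw [add_assoc, add_assoc]
    exact h1.2 (C + R) (by simp [hR]) (by rwa [← add_assoc])⟩

lemma Le.add {A B C D : Multiset α} (h1 : Le m G A B) (h2 : Le m G C D) :
    Le m G (A + C) (B + D) := by
  have e := h2.add_right B
  rw [add_comm C, add_comm D] at e
  exact (h1.add_right C).trans e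

lemma Le.sum {ι : Type*} (s : Finset ι) {A B : ι → Multiset α} (h : ∀ i, Le m G (A i) (B i)) :
    Le m G (∑ i ∈ s, A i) (∑ i ∈ s, B i) := by
  classical
  induction s using Finset.induction_on with
  | empty => simpa using Le.refl _
  | insert a s ha ih => rw [Finset.sum_insert ha, Finset.sum_insert ha]; exact (h a).add ih

lemma Le.nsmul {A B : Multiset α} (k : ℕ) (h : Le m G A B) : Le m G (k • A) (k • B) := by
  simpa using Le.sum (Finset.range k) (fun _ => h)

lemma Le.of_le (h : Core m G c) {A B : Multiset α} (hA : A ≠ 0) (hB : B ≠ 0)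
    (cA : A.card ≡ 1 [MOD m]) (cB : B.card ≡ 1 [MOD m]) (hAB : G A ≤ G B) : Le m G A B := by
  refine ⟨cA.trans cB.symm, fun R hR hc => ?_⟩
  have hR0 : R.card ≡ 0 [MOD m] := by
    rw [Multiset.card_add] at hc
    exact Nat.ModEq.add_left_cancel cA (by simpa using hc)
  rw [h.asc _ _ hA cA hR0, h.asc _ _ hB cB hR0]
  exact h.mono_le _ _ _ hAB hR0

lemma Le.le_of (h : Core m G c) {a b : ℕ} (hab : Le m G (a • {c}) (b • {c})) : a ≤ b := by
  by_contra hlt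
  push Not at hlt
  have hmod : b ≡ a [MOD m] := by simpa using hab.1.symm
  obtain ⟨t, ht⟩ := (Nat.modEq_iff_dvd' hlt.le).1 hmod
  have ht0 : 0 < t := by
    rcases Nat.eq_zero_or_pos t with rfl | h0
    · simp at ht; omega
    · exact h0
  have hm := h.hm
  -- remainder filler
  have hr : ∃ r, 1 ≤ r ∧ b + r ≡ 1 [MOD m] := by
    refine ⟨1 + b * (m - 1), by omega, ?_⟩
    obtain ⟨k, rfl⟩ : ∃ k, m = k + 1 := ⟨m - 1, by omega⟩
    have : b + (1 + b * (k + 1 - 1)) = 1 + b * (k + 1) := by simp; ring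
    rw [this]; exact modEq_one _ _
  obtain ⟨r, hr1, hr2⟩ := hr
  have e := hab.2 (r • {c}) (by rw [Ne, ← Multiset.card_eq_zero]; simp; omega) (by
    simpa using (hmod.symm.add_right r).trans hr2)
  have e2 := h.incA (b • {c} + r • {c}) (by rw [Ne, ← Multiset.card_eq_zero]; simp; omega)
    (by simpa using hr2) ht0
  simp only [zero_mul, zero_smul, add_zero] at e2
  have e3 : (b • {c} + r • {c} + (t * m) • {c} : Multiset α) = a • {c} + r • {c} := by
    have : a = b + t * m := by rw [mul_comm]; omega
    rw [this, add_smul]; abel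
  rw [e3] at e2
  exact absurd e (not_le.mpr e2)

def S (m : ℕ) (G : Multiset α → α) (c x : α) : Set ℝ :=
  {r | ∃ k p q : ℕ, 1 ≤ k ∧ 1 ≤ p ∧
    k % m = 1 % m ∧ p % m = 1 % m ∧ q % m = 0 ∧
    r = ((p : ℝ) - (q : ℝ)) / (k : ℝ) ∧
    G (k • {x} + q • {c}) < G (p • {c})}

lemma sandwich (h : Core m G c) (arch : ∀ x y, ∃ j, y < G (x ::ₘ (j * m) • {c})) (x : α) (N : ℕ) :
    ∃ a b : ℕ, Le m G ((1 + a * m) • {c}) ((1 + N * m) • {x} + (b * m) • {c}) ∧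
      Le m G ((1 + N * m) • {x} + (b * m) • {c}) ((1 + a * m + m) • {c}) := by
  obtain ⟨j, hj⟩ := arch (G ((1 + N * m) • {x})) c
  rw [← h.asc _ _ (by rw [Ne, ← Multiset.card_eq_zero]; simp) (by simp [Nat.ModEq])
    (by simp [Nat.ModEq])] at hj
  set y := G ((1 + N * m) • {x} + (j * m) • {c}) with hy
  have hex := arch c y
  classical
  obtain ⟨i, hi⟩ : ∃ i, Nat.find hex = i := ⟨_, rfl⟩
  have hspec := Nat.find_spec hex
  have hmin : ∀ t < Nat.find hex, _ := fun t ht => Nat.find_min hex ht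
  rw [hi] at hspec hmin
  rcases i with _ | i
  · simp [h.sing] at hspec
    exact absurd hspec (not_lt.mpr hj.le)
  have h2 := hmin i (by omega)
  push Not at h2
  have key : ∀ t, (c ::ₘ (t * m) • {c} : Multiset α) = (1 + t * m) • {c} := by
    intro t; rw [add_smul, one_smul, Multiset.singleton_add]
  rw [key] at hspec h2
  refine ⟨i, j, Le.of_le h ?_ ?_ ?_ ?_ h2, Le.of_le h ?_ ?_ ?_ ?_ ?_⟩
  · rw [Ne, ← Multiset.card_eq_zero]; simp
  · rw [Ne, ← Multiset.card_eq_zero]; simp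
  · simp [Nat.ModEq]
  · simp [Nat.ModEq]
  · rw [Ne, ← Multiset.card_eq_zero]; simp
  · rw [Ne, ← Multiset.card_eq_zero]; simp
  · simp [Nat.ModEq]
  · simp [Nat.ModEq]
  · have : 1 + i * m + m = 1 + (i + 1) * m := by ring
    rw [this]; exact hspec.le

lemma lower (h : Core m G c) {x : α} {k p q : ℕ} (hk : 1 ≤ k)
    (hle : Le m G (p • {c}) (k • {x} + q • {c})) {s : ℝ} (hs : s ∈ S m G c x) :
    ((p : ℝ) - q) / k ≤ s := by
  obtain ⟨k', p', q', hk', hp', mk, mp, mq, rfl, hlt⟩ := hs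
  have h2 : Le m G (k' • {x} + q' • {c}) (p' • {c}) := by
    refine Le.of_le h ?_ ?_ ?_ ?_ hlt.le
    · rw [Ne, ← Multiset.card_eq_zero]; simp; omega
    · rw [Ne, ← Multiset.card_eq_zero]; simp; omega
    · simpa using (show k' + q' ≡ 1 + 0 [MOD m] from Nat.ModEq.add mk (by simpa [Nat.ModEq] using mq))
    · simp only [Multiset.card_nsmul, Multiset.card_singleton, mul_one]; exact mp
  have h3 := (hle.nsmul k').add_right ((k * q') • {c})
  have h4 := (h2.nsmul k).add_right ((k' * q) • {c})
  have e1 : (k' • (k • {x} + q • {c}) + (k * q') • {c} : Multiset α)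
      = k • (k' • {x} + q' • {c}) + (k' * q) • {c} := by
    simp only [smul_add, ← mul_smul]
    rw [mul_comm k' k]; abel
  rw [e1] at h3
  have h5 := h3.trans h4
  rw [← mul_smul, ← mul_smul, ← add_smul, ← add_smul] at h5
  have h6 := Le.le_of h h5
  have hk0 : (0 : ℝ) < k := by exact_mod_cast hk
  have hk0' : (0 : ℝ) < k' := by exact_mod_cast hk'
  rw [div_le_div_iff₀ hk0 hk0']
  have h7 : (k' * p + k * q' : ℝ) ≤ k * p' + k' * q := by exact_mod_cast h6
  nlinarith

lemma upper (h : Core m G c) {x : α} {N a b : ℕ}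
    (hle : Le m G ((1 + N * m) • {x} + (b * m) • {c}) ((1 + a * m) • {c})) :
    (((1 + a * m : ℕ) : ℝ) + m - (b * m : ℕ)) / (1 + N * m : ℕ) ∈ S m G c x := by
  have hm := h.hm
  refine ⟨1 + N * m, 1 + (a + 2) * m, (b + 1) * m, by omega, by omega, by simp, by simp, by simp,
    ?_, ?_⟩
  · congr 1; push_cast; ring
  · have e := hle.2 (m • {c}) (by rw [Ne, ← Multiset.card_eq_zero]; simp; omega)
      (by simp [Nat.ModEq])
    have e2 := h.incA ((1 + (a + 1) * m) • {c}) (by rw [Ne, ← Multiset.card_eq_zero]; simp)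
      (by simp [Nat.ModEq]) (show 0 < 1 by omega)
    simp only [zero_mul, zero_smul, add_zero, one_mul] at e2
    rw [add_assoc, ← add_smul, ← add_smul] at e
    rw [← add_smul] at e2
    have t1 : b * m + m = (b + 1) * m := by ring
    have t2 : 1 + a * m + m = 1 + (a + 1) * m := by ring
    have t3 : 1 + (a + 1) * m + m = 1 + (a + 2) * m := by ring
    rw [t1, t2] at e
    rw [t3] at e2
    exact e.trans_lt e2

theorem main (h : Core m G c) (arch : ∀ x y, ∃ j, y < G (x ::ₘ (j * m) • {c}))
    (x : Fin (m + 1) → α) :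
    sInf (S m G c (G (∑ i, {x i}))) = ∑ i, sInf (S m G c (x i)) := by
  have hm := h.hm
  -- generic bounds
  have bounds : ∀ y (N a a' b : ℕ), Le m G ((1 + a * m) • {c}) ((1 + N * m) • {y} + (b * m) • {c}) →
      Le m G ((1 + N * m) • {y} + (b * m) • {c}) ((1 + a' * m) • {c}) →
      (((1 + a * m : ℕ) : ℝ) - (b * m : ℕ)) / (1 + N * m : ℕ) ≤ sInf (S m G c y) ∧
      sInf (S m G c y) ≤ (((1 + a' * m : ℕ) : ℝ) + m - (b * m : ℕ)) / (1 + N * m : ℕ) := by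
    intro y N a a' b h1 h2
    have hu := upper h h2
    have hl : ∀ s ∈ S m G c y, _ := fun s hs => lower h (by omega) h1 hs
    exact ⟨le_csInf ⟨_, hu⟩ hl, csInf_le ⟨_, hl⟩ hu⟩
  set y := G (∑ i, {x i}) with hy
  have hX0 : (∑ i, {x i} : Multiset α) ≠ 0 := by
    rw [Ne, ← Multiset.card_eq_zero]; simp
  have hXc : (∑ i, {x i} : Multiset α).card ≡ 1 [MOD m] := by simp [Nat.ModEq]
  have le1 : Le m G {y} (∑ i, {x i}) :=
    Le.of_le h (by simp) hX0 (by simp; rfl) hXc (by rw [h.sing])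
  have le2 : Le m G (∑ i, {x i}) {y} :=
    Le.of_le h hX0 (by simp) hXc (by simp; rfl) (by rw [h.sing])
  set Δ := sInf (S m G c y) - ∑ i, sInf (S m G c (x i)) with hΔ
  have main : ∀ N : ℕ, |Δ| * N ≤ 3 * m * (m + 1) := by
    intro N
    choose a b hab1 hab2 using fun i => h.sandwich arch (x i) N
    have hs1 := Le.sum Finset.univ hab1
    have hs2 := Le.sum Finset.univ hab2
    have emid : (∑ i, ((1 + N * m) • {x i} + (b i * m) • {c}) : Multiset α)
        = (1 + N * m) • (∑ i, {x i}) + ((∑ i, b i) * m) • {c} := by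
      rw [Finset.sum_add_distrib, Finset.smul_sum, Finset.sum_mul, Finset.sum_smul]
    have elo : (∑ i, ((1 + a i * m) • {c}) : Multiset α) = (1 + (1 + ∑ i, a i) * m) • {c} := by
      rw [← Finset.sum_smul]; congr 1
      rw [Finset.sum_add_distrib, ← Finset.sum_mul]; simp; ring
    have ehi : (∑ i, ((1 + a i * m + m) • {c}) : Multiset α)
        = (1 + (1 + (∑ i, a i) + (m + 1)) * m) • {c} := by
      rw [← Finset.sum_smul]; congr 1
      rw [Finset.sum_add_distrib, Finset.sum_add_distrib, ← Finset.sum_mul]; simp; ring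
    rw [emid, elo] at hs1
    rw [emid, ehi] at hs2
    have q1 := hs1.trans ((le2.nsmul (1 + N * m)).add_right _)
    have q2 := ((le1.nsmul (1 + N * m)).add_right _).trans hs2
    obtain ⟨B1, B2⟩ := bounds y N _ _ _ q1 q2
    have C : ∀ i, _ := fun i => bounds (x i) N (a i) (a i + 1) (b i) (hab1 i) (by
      have := hab2 i
      rwa [show 1 + a i * m + m = 1 + (a i + 1) * m by ring] at this)
    have C1 := Finset.sum_le_sum (fun i (_ : i ∈ Finset.univ) => (C i).1)
    have C2 := Finset.sum_le_sum (fun i (_ : i ∈ Finset.univ) => (C i).2)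
    rw [← Finset.sum_div] at C1 C2
    have hk0 : (0 : ℝ) < (1 + N * m : ℕ) := by positivity
    rw [div_le_iff₀ hk0] at B1 C1
    rw [le_div_iff₀ hk0] at B2 C2
    have hkN : (N : ℝ) ≤ (1 + N * m : ℕ) := by
      exact_mod_cast (by nlinarith : N ≤ 1 + N * m)
    have hm1 : (1 : ℝ) ≤ m := by exact_mod_cast hm
    generalize hK : ((1 + N * m : ℕ) : ℝ) = K at *
    push_cast at B1 B2 C1 C2
    simp only [Finset.sum_add_distrib, Finset.sum_sub_distrib, ← Finset.sum_mul,
      add_mul, Finset.sum_const, Finset.card_univ, Fintype.card_fin, nsmul_eq_mul] at B1 B2 C1 C2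
    push_cast at B1 B2 C1 C2
    have : |Δ| * K ≤ 3 * m * (m + 1) := by
      rw [← abs_of_pos hk0, ← abs_mul, abs_le, hΔ, sub_mul]
      constructor <;> nlinarith
    exact (mul_le_mul_of_nonneg_left hkN (abs_nonneg _)).trans this
  have : Δ = 0 := by
    by_contra hne
    have hpos := abs_pos.mpr hne
    obtain ⟨N, hN⟩ := exists_nat_gt ((3 * m * (m + 1) : ℝ) / |Δ|)
    rw [div_lt_iff₀ hpos] at hN
    have := main N
    nlinarith
  linarith

end Core

structure Hyp (n : ℕ) (I : Set ℝ) (f : (Fin n → ℝ) → ℝ) (g : List ℝ → ℝ) : Prop where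
  hn : 2 ≤ n
  hI : I.OrdConnected
  hmap : ∀ x : Fin n → ℝ, (∀ i, x i ∈ I) → f x ∈ I
  hcont : ContinuousOn f {x | ∀ i, x i ∈ I}
  hsym : SymmOn n I f
  hcanc : CancOn n I f
  hassoc : NAssocOn n I f
  hg1 : ∀ a : ℝ, g [a] = a
  hgn : ∀ l : List ℝ, l.length = n → g l = f (fun i : Fin n => l.getD (i : ℕ) 0)
  hgrec : ∀ l r : List ℝ, l ≠ [] → l.length % (n - 1) = 1 % (n - 1) →
      r.length = n - 1 → g (l ++ r) = g (g l :: r)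

namespace Hyp

variable {n : ℕ} {I : Set ℝ} {f : (Fin n → ℝ) → ℝ} {g : List ℝ → ℝ}

lemma getD_mem {l : List ℝ} (hl : ∀ z ∈ l, z ∈ I) {i : ℕ} (hi : i < l.length) :
    l.getD i 0 ∈ I := by
  rw [List.getD_eq_getElem _ _ hi]; exact hl _ (List.getElem_mem hi)

lemma gn_mem (h : Hyp n I f g) {l : List ℝ} (hl : ∀ z ∈ l, z ∈ I) (hlen : l.length = n) :
    g l ∈ I := by
  rw [h.hgn l hlen]
  exact h.hmap _ fun i => getD_mem hl (by rw [hlen]; exact i.2)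

/-- decomposition of a list of admissible length -/
lemma split_len (h : Hyp n I f g) {l : List ℝ} (hne : l ≠ [])
    (hlen : l.length % (n - 1) = 1 % (n - 1)) :
    l.length = 1 ∨ ∃ u r, u ≠ [] ∧ u.length % (n - 1) = 1 % (n - 1) ∧ r.length = n - 1 ∧
      l = u ++ r := by
  have hn := h.hn
  have hpos := List.length_pos_iff.2 hne
  by_cases h1 : l.length = 1
  · exact Or.inl h1
  right
  have hge : n ≤ l.length := by
    have hd : (n - 1) ∣ l.length - 1 := (Nat.modEq_iff_dvd' hpos).1 (Eq.symm hlen)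
    have := Nat.le_of_dvd (by omega) hd
    omega
  have hu : (l.take (l.length - (n - 1))).length = l.length - (n - 1) := by
    rw [List.length_take]; omega
  refine ⟨l.take (l.length - (n - 1)), l.drop (l.length - (n - 1)), ?_, ?_, ?_, ?_⟩
  · rw [← List.length_pos_iff, hu]; omega
  · rw [hu, ← hlen]; exact (Nat.mod_eq_sub_mod (by omega)).symm
  · rw [List.length_drop]; omega
  · simp

lemma g_mem (h : Hyp n I f g) : ∀ (N : ℕ) (l : List ℝ), l.length = N → (∀ z ∈ l, z ∈ I) → l ≠ [] →
    l.length % (n - 1) = 1 % (n - 1) → g l ∈ I := by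
  intro N
  induction N using Nat.strong_induction_on with
  | _ N ih =>
    intro l hN hl hne hlen
    have hn := h.hn
    rcases h.split_len hne hlen with h1 | ⟨u, r, hu, hul, hr, rfl⟩
    · obtain ⟨a, rfl⟩ := List.length_eq_one_iff.1 h1
      rw [h.hg1]; exact hl a (by simp)
    · rw [h.hgrec u r hu hul hr]
      have := ih u.length (by rw [List.length_append] at hN; omega) u rfl
        (fun z hz => hl z (by simp [hz])) hu hul
      apply h.gn_mem
      · intro z hz
        rcases List.mem_cons.1 hz with rfl | hz
        · exact this
        · exact hl z (by simp [hz])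
      · simp; omega

lemma swap_n (h : Hyp n I f g) (l1 l2 : List ℝ) (a b : ℝ) (hlen : (l1 ++ a :: b :: l2).length = n)
    (hl : ∀ z ∈ l1 ++ a :: b :: l2, z ∈ I) :
    g (l1 ++ a :: b :: l2) = g (l1 ++ b :: a :: l2) := by
  have hlen' : (l1 ++ b :: a :: l2).length = n := by simpa using hlen
  rw [h.hgn _ hlen, h.hgn _ hlen']
  have hl2 : l1.length + 2 ≤ n := by simp at hlen; omega
  have := h.hsym (fun i : Fin n => (l1 ++ a :: b :: l2).getD (i : ℕ) 0)
    (fun i => getD_mem hl (by rw [hlen]; exact i.2))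
    (Equiv.swap ⟨l1.length, by omega⟩ ⟨l1.length + 1, by omega⟩)
  rw [← this]
  congr 1
  funext i
  simp only [Function.comp]
  by_cases e1 : (i : ℕ) = l1.length
  · have : i = ⟨l1.length, by omega⟩ := Fin.ext e1
    rw [this]
    rw [Equiv.swap_apply_left]
    simp [List.getD]
  by_cases e2 : (i : ℕ) = l1.length + 1
  · have : i = ⟨l1.length + 1, by omega⟩ := Fin.ext e2
    rw [this]
    rw [Equiv.swap_apply_right]
    simp [List.getD]
  rw [Equiv.swap_apply_of_ne_of_ne (fun e => e1 (by rw [e])) (fun e => e2 (by rw [e]))]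
  rcases lt_or_ge (i : ℕ) l1.length with hlt | hge
  · simp [List.getD, List.getElem?_append_left hlt]
  · obtain ⟨t, ht⟩ : ∃ t, (i : ℕ) = l1.length + (t + 2) := ⟨i - l1.length - 2, by omega⟩
    simp only [List.getD, ht]
    rw [List.getElem?_append_right (by omega), List.getElem?_append_right (by omega)]
    simp

lemma assoc_list (h : Hyp n I f g) (a b : ℝ) (s v : List ℝ) (hs : s.length = n - 1)
    (hv : v.length = n - 2) (hl : ∀ z ∈ a :: s ++ b :: v, z ∈ I) :
    g (g (a :: s) :: b :: v) = g (a :: g (s ++ [b]) :: v) := by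
  have hn := h.hn
  have hL : (a :: s ++ b :: v).length = 2 * n - 1 := by simp; omega
  have key := h.hassoc (fun j => (a :: s ++ b :: v).getD j 0)
    (fun j hj => getD_mem hl (by omega)) 0 (by omega)
  rw [h.hgn (a :: s) (by simp; omega), h.hgn (s ++ [b]) (by simp; omega),
    h.hgn (_ :: b :: v) (by simp; omega), h.hgn (a :: _ :: v) (by simp; omega)]
  convert key using 2
  · funext j
    rcases j with ⟨j, hj⟩
    rcases j with _ | j
    · simp only [List.getD_cons_zero, lt_irrefl, if_false, if_true]
      congr 1
      funext l
      rw [Nat.zero_add, List.getD_append _ _ _ _ (by have := l.2; simp; omega)]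
    · have e : j + 1 + n - 1 = (a :: s).length + j := by simp; omega
      simp only [List.getD_cons_succ, e, Nat.not_lt_zero, if_false, Nat.succ_ne_zero]
      rw [List.getD_append_right _ _ _ _ (by omega)]
      simp
  · funext j
    rcases j with ⟨j, hj⟩
    rcases j with _ | _ | j
    · simp
    · simp only [List.getD_cons_succ, List.getD_cons_zero, Nat.zero_add, lt_irrefl, if_false, if_true]
      congr 1
      funext l
      rw [Nat.add_comm 1, List.cons_append, List.getD_cons_succ,
        show s ++ b :: v = (s ++ [b]) ++ v by simp,
        List.getD_append (s ++ [b]) v _ _ (by have := l.2; simp; omega)]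
    · have e : j + 1 + 1 + n - 1 = (a :: (s ++ [b])).length + j := by simp; omega
      simp only [List.getD_cons_succ, e]
      rw [if_neg (by omega), if_neg (by omega),
        show a :: s ++ b :: v = (a :: (s ++ [b])) ++ v by simp,
        List.getD_append_right _ _ _ _ (by omega)]
      simp

lemma swap_any (h : Hyp n I f g) : ∀ (N : ℕ) (l1 l2 : List ℝ) (a b : ℝ), l2.length = N →
    (l1 ++ a :: b :: l2).length % (n - 1) = 1 % (n - 1) →
    (∀ z ∈ l1 ++ a :: b :: l2, z ∈ I) →
    g (l1 ++ a :: b :: l2) = g (l1 ++ b :: a :: l2) := by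
  intro N
  induction N using Nat.strong_induction_on with
  | _ N ih =>
    intro l1 l2 a b hN hlen hl
    have hn := h.hn
    rcases h.split_len (by simp) hlen with h1 | ⟨u, r, hu, hul, hr, e⟩
    · simp at h1; omega
    have hlen' := congrArg List.length e
    simp only [List.length_append, List.length_cons] at hlen'
    have hupos := List.length_pos_iff.2 hu
    rcases lt_trichotomy l2.length (n - 2) with hlt | heq | hgt
    · -- both in r
      obtain ⟨s, rfl, rfl⟩ : ∃ s, l1 = u ++ s ∧ r = s ++ a :: b :: l2 := by
        rcases List.append_eq_append_iff.1 e with ⟨as, h1, h2⟩ | ⟨bs, h1, h2⟩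
        · have := congrArg List.length h2
          simp at this
          have : as = [] := List.length_eq_zero_iff.1 (by omega)
          subst this
          exact ⟨[], by simpa using h1.symm, by simpa using h2.symm⟩
        · exact ⟨bs, h1, h2⟩
      have hr' : (s ++ b :: a :: l2).length = n - 1 := by simpa using hr
      rw [List.append_assoc, List.append_assoc, h.hgrec _ _ hu hul hr, h.hgrec _ _ hu hul hr']
      rw [← List.cons_append, ← List.cons_append]
      apply h.swap_n
      · simp at hr ⊢; omega
      · intro z hz
        simp only [List.cons_append, List.mem_cons] at hz
        rcases hz with rfl | hz
        · exact h.g_mem _ _ rfl (fun z hz => hl z (by simp [hz])) hu hul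
        · exact hl z (by rw [List.append_assoc]; exact List.mem_append_right _ hz)
    · -- across
      obtain ⟨rfl, rfl⟩ : u = l1 ++ [a] ∧ r = b :: l2 := by
        have e' : (l1 ++ [a]) ++ (b :: l2) = u ++ r := by simpa using e
        have := List.append_inj_right' e' (by simp; omega)
        exact ⟨(List.append_inj_left' e' (by simp; omega)).symm, this.symm⟩
      by_cases hl1 : l1 = []
      · subst hl1
        exact h.swap_n [] l2 a b (by simp; omega) hl
      have hl1p := List.length_pos_iff.2 hl1
      rcases h.split_len hu hul with h1 | ⟨w, t, hw, hwl, ht, e2⟩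
      · simp at h1; exact absurd h1 hl1
      have hlen2 := congrArg List.length e2
      simp only [List.length_append, List.length_cons, List.length_nil] at hlen2
      obtain ⟨s, rfl, rfl⟩ : ∃ s, l1 = w ++ s ∧ t = s ++ [a] := by
        rcases List.append_eq_append_iff.1 e2 with ⟨as, h1, h2⟩ | ⟨bs, h1, h2⟩
        · have := congrArg List.length h2
          simp at this
          have : as = [] := List.length_eq_zero_iff.1 (by omega)
          subst this
          exact ⟨[], by simpa using h1.symm, by simpa using h2.symm⟩
        · exact ⟨bs, h1, h2⟩
      have gw : g w ∈ I := h.g_mem _ _ rfl (fun z hz => hl z (by simp [hz])) hw hwl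
      have step : ∀ a b : ℝ, a ∈ I → b ∈ I →
          g (w ++ s ++ a :: b :: l2) = g (g w :: g (s ++ [a, b]) :: l2) := by
        intro a' b' ha' hb'
        rw [show w ++ s ++ a' :: b' :: l2 = (w ++ s ++ [a']) ++ (b' :: l2) by simp]
        have hul' : (w ++ s ++ [a']).length % (n - 1) = 1 % (n - 1) := by simpa using hul
        have ht' : (s ++ [a']).length = n - 1 := by simpa using ht
        rw [h.hgrec _ _ (by simp) hul' (by simp; omega),
          List.append_assoc w s, h.hgrec w _ hw hwl ht', h.assoc_list _ _ _ _ ht' (by omega)]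
        · simp
        · intro z hz
          simp only [List.cons_append, List.mem_cons, List.mem_append, List.not_mem_nil,
            or_false] at hz
          rcases hz with rfl | (hz | rfl) | rfl | hz
          · exact gw
          · exact hl z (by simp [hz])
          · exact ha'
          · exact hb'
          · exact hl z (by simp [hz])
      have haI : a ∈ I := hl a (by simp)
      have hbI : b ∈ I := hl b (by simp)
      rw [step a b haI hbI, step b a hbI haI]
      rw [h.swap_n s [] a b]
      · simp at ht ⊢; omega
      · intro z hz
        exact hl z (by simp at hz ⊢; tauto)
    · -- inside u
      obtain ⟨s, rfl, rfl⟩ : ∃ s, u = l1 ++ a :: b :: s ∧ l2 = s ++ r := by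
        have e' : (l1 ++ [a, b]) ++ l2 = u ++ r := by simpa using e
        rcases List.append_eq_append_iff.1 e' with ⟨as, h1, h2⟩ | ⟨bs, h1, h2⟩
        · exact ⟨as, by simpa using h1, h2⟩
        · have := congrArg List.length h2
          simp at this
          have : bs = [] := List.length_eq_zero_iff.1 (by omega)
          subst this
          exact ⟨[], by simpa using h1.symm, by simpa using h2.symm⟩
      have hul' : (l1 ++ b :: a :: s).length % (n - 1) = 1 % (n - 1) := by simpa using hul
      rw [show l1 ++ a :: b :: (s ++ r) = (l1 ++ a :: b :: s) ++ r by simp,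
        show l1 ++ b :: a :: (s ++ r) = (l1 ++ b :: a :: s) ++ r by simp,
        h.hgrec _ _ hu hul hr, h.hgrec _ _ (by simp) hul' hr]
      rw [ih s.length (by simp at hN; omega) l1 s a b rfl hul
        (fun z hz => hl z (by simp at hz ⊢; tauto))]

lemma perm_aux (h : Hyp n I f g) {l l' : List ℝ} (hp : l.Perm l') : ∀ l1 : List ℝ,
    (l1 ++ l).length % (n - 1) = 1 % (n - 1) → (∀ z ∈ l1 ++ l, z ∈ I) →
    g (l1 ++ l) = g (l1 ++ l') := by
  induction hp with
  | nil => intros; rfl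
  | cons x hp ih =>
    intro l1 h1 h2
    have := ih (l1 ++ [x]) (by simpa using h1) (by simpa using h2)
    simpa using this
  | swap x y l =>
    intro l1 h1 h2
    exact h.swap_any _ l1 l y x rfl h1 h2
  | trans p1 p2 ih1 ih2 =>
    intro l1 h1 h2
    rw [ih1 l1 h1 h2, ih2 l1 (by simpa [p1.length_eq] using h1) (fun z hz => h2 z (by
      simp only [List.mem_append] at hz ⊢
      rwa [p1.mem_iff]))]

lemma perm (h : Hyp n I f g) {l l' : List ℝ} (hp : l.Perm l')
    (hlen : l.length % (n - 1) = 1 % (n - 1)) (hl : ∀ z ∈ l, z ∈ I) : g l = g l' := by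
  simpa using h.perm_aux hp [] (by simpa using hlen) (by simpa using hl)

lemma split_zero (h : Hyp n I f g) {r : List ℝ} (hlen : r.length % (n - 1) = 0) (hr : r ≠ []) :
    ∃ u v, u.length % (n - 1) = 0 ∧ v.length = n - 1 ∧ r = u ++ v := by
  have hn := h.hn
  have hpos := List.length_pos_iff.2 hr
  have hge : n - 1 ≤ r.length := Nat.le_of_dvd hpos (Nat.dvd_of_mod_eq_zero hlen)
  refine ⟨r.take (r.length - (n - 1)), r.drop (r.length - (n - 1)), ?_, ?_, by simp⟩
  · rw [List.length_take, min_eq_left (by omega), ← hlen]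
    exact (Nat.mod_eq_sub_mod hge).symm
  · rw [List.length_drop]; omega

lemma len_aux {m : ℕ} {l u : ℕ} (hl : l % m = 1 % m) (hu : u % m = 0) : (l + u) % m = 1 % m := by
  rw [Nat.add_mod, hl, hu]; simp

lemma asc (h : Hyp n I f g) (l : List ℝ) (hl : l ≠ []) (hll : l.length % (n - 1) = 1 % (n - 1)) :
    ∀ (N : ℕ) (r : List ℝ), r.length = N → r.length % (n - 1) = 0 → g (l ++ r) = g (g l :: r) := by
  intro N
  induction N using Nat.strong_induction_on with
  | _ N ih =>
    intro r hN hr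
    have hn := h.hn
    by_cases hr0 : r = []
    · subst hr0; simp [h.hg1]
    obtain ⟨u, v, hu, hv, rfl⟩ := h.split_zero hr hr0
    rw [← List.append_assoc, h.hgrec _ v (by simp [hl]) (by
        rw [List.length_append]; exact len_aux hll hu) hv,
      ih u.length (by simp at hN; omega) u rfl hu, ← List.cons_append, h.hgrec _ v (by simp) (by
        simpa [add_comm] using len_aux (m := n - 1) rfl hu) hv]

lemma sign (h : Hyp n I f g) (k : Fin n) :
    (∀ (a b : ℝ) (v : Fin n → ℝ), a ∈ I → b ∈ I → (∀ i, v i ∈ I) → a < b →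
      f (Function.update v k a) < f (Function.update v k b)) ∨
    (∀ (a b : ℝ) (v : Fin n → ℝ), a ∈ I → b ∈ I → (∀ i, v i ∈ I) → a < b →
      f (Function.update v k b) < f (Function.update v k a)) := by
  by_contra hcon
  push Not at hcon
  obtain ⟨⟨a, b, v, ha, hb, hv, hab, h1⟩, ⟨a', b', v', ha', hb', hv', hab', h2⟩⟩ := hcon
  have upd : ∀ (v : Fin n → ℝ) (a : ℝ), (∀ i, v i ∈ I) → a ∈ I → ∀ i, Function.update v k a i ∈ I := by
    intro v a hv ha i
    by_cases e : i = k
    · subst e; simpa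
    · simpa [e] using hv i
  let K : Set (ℝ × ℝ × (Fin n → ℝ)) := {z | z.1 ∈ I ∧ z.2.1 ∈ I ∧ (∀ i, z.2.2 i ∈ I) ∧ z.1 < z.2.1}
  have cI : Convex ℝ I := h.hI.convex
  have cK : Convex ℝ K := by
    intro z hz w hw s t hs ht hst
    refine ⟨cI hz.1 hw.1 hs ht hst, cI hz.2.1 hw.2.1 hs ht hst,
      fun i => cI (hz.2.2.1 i) (hw.2.2.1 i) hs ht hst, ?_⟩
    have e1 := hz.2.2.2
    have e2 := hw.2.2.2
    simp only [Prod.fst_add, Prod.smul_fst, Prod.snd_add, Prod.smul_snd, smul_eq_mul]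
    rcases hs.eq_or_lt with rfl | hs
    · have : t = 1 := by linarith
      subst this; simpa using e2
    · nlinarith
  let F : ℝ × ℝ × (Fin n → ℝ) → ℝ := fun z =>
    f (Function.update z.2.2 k z.2.1) - f (Function.update z.2.2 k z.1)
  have hF : ContinuousOn F K := by
    apply ContinuousOn.sub
    · apply h.hcont.comp (Continuous.continuousOn (by fun_prop))
      intro z hz
      exact upd _ _ hz.2.2.1 hz.2.1
    · apply h.hcont.comp (Continuous.continuousOn (by fun_prop))
      intro z hz
      exact upd _ _ hz.2.2.1 hz.1
  have z1 : ((a, b, v) : ℝ × ℝ × (Fin n → ℝ)) ∈ K := ⟨ha, hb, hv, hab⟩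
  have z2 : ((a', b', v') : ℝ × ℝ × (Fin n → ℝ)) ∈ K := ⟨ha', hb', hv', hab'⟩
  have hmem := cK.isPreconnected.intermediate_value z1 z2 hF
    (show (0 : ℝ) ∈ _ from ⟨sub_nonpos.2 h1, sub_nonneg.2 h2⟩)
  obtain ⟨⟨p, q, w⟩, ⟨hp, hq, hw, hpq⟩, hz⟩ := hmem
  simp only [F] at hz hp hq hw hpq
  have := h.hcanc k _ _ (upd w q hw hq) (upd w p hw hp)
    (fun i hi => by simp [hi]) (sub_eq_zero.1 hz)
  simp at this
  linarith

lemma cons_fun' (h : Hyp n I f g) (a e : ℝ) (r : List ℝ) (hr : r.length = n - 1) :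
    g (a :: r) = f (Function.update (fun i : Fin n => (e :: r).getD (i : ℕ) 0)
      ⟨0, by have := h.hn; omega⟩ a) := by
  have hn := h.hn
  rw [h.hgn _ (by simp; omega)]
  congr 1
  funext i
  rcases i with ⟨i, hi⟩
  rcases i with _ | i
  · simp
  · rw [Function.update_of_ne (by simp)]
    simp

lemma mono_base (h : Hyp n I f g) (hne : ∃ a ∈ I, ∃ b ∈ I, a ≠ b) (a b : ℝ) (r : List ℝ)
    (hr : r.length = n - 1) (hrI : ∀ z ∈ r, z ∈ I) (ha : a ∈ I) (hb : b ∈ I) (hab : a < b) :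
    g (a :: r) < g (b :: r) := by
  have hn := h.hn
  have memv : ∀ (e : ℝ) (r : List ℝ), r.length = n - 1 → e ∈ I → (∀ z ∈ r, z ∈ I) →
      ∀ i : Fin n, (e :: r).getD (i : ℕ) 0 ∈ I := by
    intro e r hr he hrI i
    refine getD_mem ?_ (by have := i.2; simp; omega)
    intro z hz
    rcases List.mem_cons.1 hz with rfl | hz
    · exact he
    · exact hrI z hz
  rcases h.sign ⟨0, by omega⟩ with hs | hs
  · rw [h.cons_fun' a a r hr, h.cons_fun' b a r hr]
    exact hs a b _ ha hb (memv a r hr ha hrI) hab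
  · exfalso
    have dec : ∀ (a b : ℝ) (r : List ℝ), r.length = n - 1 → (∀ z ∈ r, z ∈ I) → a ∈ I → b ∈ I →
        a < b → g (b :: r) < g (a :: r) := by
      intro a b r hr hrI ha hb hab
      rw [h.cons_fun' a a r hr, h.cons_fun' b a r hr]
      exact hs a b _ ha hb (memv a r hr ha hrI) hab
    obtain ⟨e, v, rfl⟩ : ∃ e v, r = e :: v := by
      cases r with
      | nil => simp at hr; omega
      | cons e v => exact ⟨e, v, rfl⟩
    have memc : ∀ a ∈ I, ∀ z ∈ a :: e :: v, z ∈ I := by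
      intro a ha z hz
      rcases List.mem_cons.1 hz with rfl | hz
      · exact ha
      · exact hrI z hz
    have d1 := dec a b _ hr hrI ha hb hab
    have gma := h.gn_mem (memc a ha) (by rw [List.length_cons]; omega)
    have gmb := h.gn_mem (memc b hb) (by rw [List.length_cons]; omega)
    have d2 := dec _ _ _ hr hrI gmb gma d1
    have hv : v.length = n - 2 := by simp at hr; omega
    have memcc : ∀ a ∈ I, ∀ z ∈ a :: (e :: v) ++ e :: v, z ∈ I := by
      intro a ha z hz
      rcases List.mem_append.1 hz with hz | hz
      · exact memc a ha z hz
      · exact hrI z hz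
    rw [h.assoc_list a e (e :: v) v hr hv (memcc a ha),
      h.assoc_list b e (e :: v) v hr hv (memcc b hb)] at d2
    have gmr : g ((e :: v) ++ [e]) ∈ I := h.gn_mem (by
      intro z hz
      rcases List.mem_append.1 hz with hz | hz
      · exact hrI z hz
      · simp at hz; subst hz; exact hrI z (by simp)) (by simp; omega)
    have d3 := dec a b (g ((e :: v) ++ [e]) :: v) (by simp; omega) (by
      intro z hz
      rcases List.mem_cons.1 hz with rfl | hz
      · exact gmr
      · exact hrI z (by simp [hz])) ha hb hab
    exact absurd d2 (not_lt.mpr d3.le)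

lemma mono (h : Hyp n I f g) (hne : ∃ a ∈ I, ∃ b ∈ I, a ≠ b) (a b : ℝ)
    (ha : a ∈ I) (hb : b ∈ I) (hab : a < b) : ∀ (N : ℕ) (r : List ℝ), r.length = N →
    r.length % (n - 1) = 0 → (∀ z ∈ r, z ∈ I) → g (a :: r) < g (b :: r) := by
  intro N
  induction N using Nat.strong_induction_on with
  | _ N ih =>
    intro r hN hr hrI
    have hn := h.hn
    by_cases hr0 : r = []
    · subst hr0; simpa [h.hg1] using hab
    obtain ⟨u, v, hu, hv, rfl⟩ := h.split_zero hr hr0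
    have hl : ∀ a : ℝ, (a :: u).length % (n - 1) = 1 % (n - 1) := fun a => by
      simpa [add_comm] using len_aux (m := n - 1) rfl hu
    have huI : ∀ z ∈ u, z ∈ I := fun z hz => hrI z (by simp [hz])
    have hm : ∀ a ∈ I, g (a :: u) ∈ I := fun a ha => h.g_mem _ _ rfl (by
      intro z hz
      rcases List.mem_cons.1 hz with rfl | hz
      · exact ha
      · exact huI z hz) (by simp) (hl a)
    rw [← List.cons_append, ← List.cons_append, h.hgrec _ v (by simp) (hl a) hv,
      h.hgrec _ v (by simp) (hl b) hv]
    exact h.mono_base hne _ _ v hv (fun z hz => hrI z (by simp [hz])) (hm a ha) (hm b hb)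
      (ih u.length (by simp at hN; omega) u rfl hu huI)

end Hyp

namespace Hyp

open Filter Topology

variable {m : ℕ} {I : Set ℝ} {f : (Fin (m + 1) → ℝ) → ℝ} {g : List ℝ → ℝ}

open Classical in
noncomputable def GG (g : List ℝ → ℝ) (c : I) (M : Multiset I) : I :=
  if h : g (M.toList.map Subtype.val) ∈ I then ⟨_, h⟩ else c

lemma GG_coe (h : Hyp (m + 1) I f g) (c : I) (l : List I) (hl : l ≠ [])
    (hlen : l.length ≡ 1 [MOD m]) : (GG g c (l : Multiset I) : ℝ) = g (l.map Subtype.val) := by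
  have hp : ((l : Multiset I).toList.map Subtype.val).Perm (l.map Subtype.val) :=
    (Multiset.coe_eq_coe.1 (Multiset.coe_toList _)).map _
  have hI : ∀ l : List I, ∀ z ∈ l.map Subtype.val, z ∈ I := by
    intro l z hz
    obtain ⟨w, _, rfl⟩ := List.mem_map.1 hz
    exact w.2
  have e := h.perm hp (by rw [hp.length_eq, List.length_map]; exact hlen) (hI _)
  have hmem : g (l.map Subtype.val) ∈ I :=
    h.g_mem _ _ rfl (hI l) (by rwa [Ne, List.map_eq_nil_iff]) (by rw [List.length_map]; exact hlen)
  unfold GG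
  rw [dif_pos (by rw [e]; exact hmem)]
  exact e

lemma core (h : Hyp (m + 1) I f g) (hne : ∃ a ∈ I, ∃ b ∈ I, a ≠ b) (c : I)
    (hcf : (c : ℝ) < f (fun _ => c)) : Core m (GG g c) c := by
  have hn := h.hn
  refine ⟨by omega, ?_, ?_, ?_, ?_⟩
  · intro a
    apply Subtype.ext
    have := h.GG_coe c [a] (by simp) rfl
    simpa [h.hg1] using this
  · intro A B
    induction A using Quotient.inductionOn with | _ l => ?_
    induction B using Quotient.inductionOn with | _ r => ?_
    intro hA cA cB
    simp only [Multiset.quot_mk_to_coe, Multiset.coe_card, Multiset.coe_add, ne_eq,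
      Multiset.coe_eq_zero, Multiset.cons_coe] at *
    apply Subtype.ext
    rw [h.GG_coe c _ (by simp [hA]) (by simpa using cA.add cB),
      h.GG_coe c _ (by simp) (by simpa using cB.add_right 1), List.map_append, List.map_cons,
      h.GG_coe c _ hA cA]
    exact h.asc _ (by rwa [Ne, List.map_eq_nil_iff]) (by rw [List.length_map]; exact cA) _ _ rfl (by
      simpa [Nat.ModEq] using cB)
  · intro a b R hab
    induction R using Quotient.inductionOn with | _ r => ?_
    intro cB
    simp only [Multiset.quot_mk_to_coe, Multiset.coe_card, Multiset.cons_coe] at *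
    rw [← Subtype.coe_lt_coe, h.GG_coe c _ (by simp) (by simpa using cB.add_right 1),
      h.GG_coe c _ (by simp) (by simpa using cB.add_right 1), List.map_cons, List.map_cons]
    refine h.mono hne _ _ a.2 b.2 hab _ _ rfl (by simpa [Nat.ModEq] using cB) ?_
    intro z hz
    obtain ⟨w, _, rfl⟩ := List.mem_map.1 hz
    exact w.2
  · rw [← Subtype.coe_lt_coe, Multiset.nsmul_singleton, ← Multiset.coe_replicate,
      h.GG_coe c _ (by simp) (by simp [Nat.ModEq]), h.hgn _ (by simp)]
    refine lt_of_lt_of_eq hcf (congrArg f ?_)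
    funext i
    have := i.2
    rw [List.getD_eq_getElem _ _ (by simp; omega)]
    simp

lemma arch (h : Hyp (m + 1) I f g) (hne : ∃ a ∈ I, ∃ b ∈ I, a ≠ b) (c : I)
    (hcf : (c : ℝ) < f (fun _ => c)) (x y : I) :
    ∃ j, y < GG g c (x ::ₘ (j * m) • {c}) := by
  have hn := h.hn
  have hc := h.core hne c hcf
  by_contra hcon
  push Not at hcon
  let u : ℕ → ℝ := fun j => (GG g c (x ::ₘ (j * m) • {c}) : ℝ)
  have hmono : StrictMono u := by
    have := hc.incA {x} (by simp) (by simp; rfl)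
    intro i j hij
    exact this hij
  have hbdd : BddAbove (Set.range u) := ⟨y, by rintro _ ⟨j, rfl⟩; exact hcon j⟩
  have hlim := tendsto_atTop_ciSup hmono.monotone hbdd
  set L := ⨆ j, u j with hL
  have hLI : L ∈ I := h.hI.out (GG g c (x ::ₘ (0 * m) • {c})).2 y.2
    ⟨le_ciSup hbdd 0, ciSup_le fun j => hcon j⟩
  let k : Fin (m + 1) := ⟨0, by omega⟩
  let v : Fin (m + 1) → ℝ := fun _ => c
  have base : ∀ a : I, (GG g c (a ::ₘ m • {c}) : ℝ) = f (Function.update v k a) := by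
    intro a
    rw [Multiset.nsmul_singleton, ← Multiset.coe_replicate, Multiset.cons_coe,
      h.GG_coe c _ (by simp) (by simp [Nat.ModEq]), List.map_cons, h.cons_fun' _ c _ (by simp)]
    congr 2
    funext i
    have := i.2
    rw [List.getD_eq_getElem _ _ (by simp; omega)]
    rcases i with ⟨i, hi⟩
    rcases i with _ | i <;> simp [v]
  have step : ∀ j, u (j + 1) = f (Function.update v k (u j)) := by
    intro j
    rw [← base, ← hc.asc _ _ (by simp) (by simp [Nat.ModEq]) (by simp [Nat.ModEq])]
    simp only [u]
    congr 2
    rw [Multiset.cons_add, ← add_smul, add_mul, one_mul]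
  have upd : ∀ a ∈ I, Function.update v k a ∈ {x : Fin (m + 1) → ℝ | ∀ i, x i ∈ I} := by
    intro a ha i
    by_cases e : i = k
    · subst e; simpa
    · simp only [Function.update_of_ne e, v]; exact c.2
  have ct := h.hcont _ (upd L hLI)
  have t1 : Tendsto (fun j => Function.update v k (u j)) atTop
      (𝓝[{x : Fin (m + 1) → ℝ | ∀ i, x i ∈ I}] (Function.update v k L)) := by
    apply tendsto_nhdsWithin_iff.2
    refine ⟨?_, Eventually.of_forall fun j => upd _ (GG g c (x ::ₘ (j * m) • {c})).2⟩
    have hcu : Continuous (fun a : ℝ => Function.update v k a) := by fun_prop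
    exact (hcu.tendsto L).comp hlim
  have t2 := ct.tendsto.comp t1
  have t3 : Tendsto (fun j => u (j + 1)) atTop (𝓝 L) := hlim.comp (tendsto_add_atTop_nat 1)
  have heq : L = f (Function.update v k L) := tendsto_nhds_unique t3 (by
    refine t2.congr fun j => (step j).symm)
  have hinc := hc.inc ⟨L, hLI⟩
  rw [← Subtype.coe_lt_coe, base] at hinc
  simp only at hinc
  linarith

lemma S_eq (h : Hyp (m + 1) I f g) (c x : I) :
    Core.S m (GG g c) c x = SxSet (m + 1) g c x := by
  ext r
  simp only [Core.S, SxSet, Set.mem_ofPred_eq, Nat.add_sub_cancel]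
  refine exists_congr fun k => exists_congr fun p => exists_congr fun q => ?_
  refine and_congr_right fun hk => and_congr_right fun hp => and_congr_right fun mk =>
    and_congr_right fun mp => and_congr_right fun mq => and_congr_right fun _ => ?_
  rw [← Subtype.coe_lt_coe, Multiset.nsmul_singleton, Multiset.nsmul_singleton,
    Multiset.nsmul_singleton, ← Multiset.coe_replicate, ← Multiset.coe_replicate,
    ← Multiset.coe_replicate, Multiset.coe_add, h.GG_coe, h.GG_coe]
  · simp
  · rw [← List.length_pos_iff]; simp; omega
  · simp only [List.length_replicate]; exact mp
  · rw [← List.length_pos_iff]; simp; omega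
  · simp only [List.length_append, List.length_replicate]
    exact len_aux mk mq

lemma G_sum (h : Hyp (m + 1) I f g) (c : I) (x : Fin (m + 1) → I) :
    (GG g c (∑ i, {x i}) : ℝ) = f (fun i => x i) := by
  have e : (∑ i, {x i} : Multiset I) = (List.ofFn x : Multiset I) := by
    rw [← List.sum_ofFn]
    have : ∀ l : List I, (l.map (fun a => ({a} : Multiset I))).sum = (l : Multiset I) := by
      intro l
      induction l with
      | nil => rfl
      | cons a l ih => simp [ih]
    rw [← this, List.map_ofFn]; rfl
  rw [e, h.GG_coe c _ (by simp) (by simp [Nat.ModEq]), h.hgn _ (by simp)]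
  congr 1
  funext i
  have := i.2
  rw [List.getD_eq_getElem _ _ (by simp; omega), List.getElem_map, List.getElem_ofFn]

end Hyp

/-- Claim 9: with `φ(x) = inf S_x`, one has `φ(f(x₁,…,xₙ)) = ∑ᵢ φ(xᵢ)` for all
`x₁,…,xₙ ∈ I`; i.e. `φ` is an `n`-ary semigroup homomorphism from `(I, f)` to
`(ℝ, +)`. -/
theorem stmt_16 (n : ℕ) (hn : 2 ≤ n) (I : Set ℝ) (hI : I.OrdConnected)
    (hne : ∃ a ∈ I, ∃ b ∈ I, a ≠ b)
    (f : (Fin n → ℝ) → ℝ)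
    (hmap : ∀ x : Fin n → ℝ, (∀ i, x i ∈ I) → f x ∈ I)
    (hcont : ContinuousOn f {x | ∀ i, x i ∈ I})
    (hsym : SymmOn n I f) (hcanc : CancOn n I f) (hassoc : NAssocOn n I f)
    (g : List ℝ → ℝ)
    -- g is the n-associative extension of f with g₁ = id:
    (hg1 : ∀ a : ℝ, g [a] = a)
    (hgn : ∀ l : List ℝ, l.length = n → g l = f (fun i : Fin n => l.getD (i : ℕ) 0))
    (hgrec : ∀ l r : List ℝ, l ≠ [] → l.length % (n - 1) = 1 % (n - 1) →
      r.length = n - 1 → g (l ++ r) = g (g l :: r))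
    (c : ℝ) (hc : c ∈ I) (hcf : c < f (fun _ => c))
    :
    ∀ x : Fin n → ℝ, (∀ i, x i ∈ I) →
      sInf (SxSet n g c (f x)) = ∑ i : Fin n, sInf (SxSet n g c (x i)) := by
  have h : Hyp n I f g := ⟨hn, hI, hmap, hcont, hsym, hcanc, hassoc, hg1, hgn, hgrec⟩
  obtain ⟨m, rfl⟩ : ∃ m, n = m + 1 := ⟨n - 1, by omega⟩
  intro x hx
  have hcore := h.core hne ⟨c, hc⟩ hcf
  have key := hcore.main (h.arch hne ⟨c, hc⟩ hcf) (fun i => ⟨x i, hx i⟩)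
  simp only [h.S_eq] at key
  rw [h.G_sum ⟨c, hc⟩ (fun i => ⟨x i, hx i⟩)] at key
  exact key
end

section
/- Main Theorem: A function f : Iⁿ → I on a nontrivial real interval I is continuous, symmetric, cancellative, and associative if and only if there exists a continuous strictly increasing function φ : I → J onto a real interval J of one of the forms (-∞,b), (-∞,b], (a,∞), [a,∞), or ℝ (b ≤ 0 ≤ a) such that f(x₁,…,xₙ) = φ⁻¹(Σᵢ₌₁ⁿ φ(xᵢ)) for all x₁,…,xₙ ∈ I. -/
/-- `J` is a real interval of one of the forms `(-∞,b)`, `(-∞,b]`, `(a,∞)`, `[a,∞)`,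
or `ℝ`, with `b ≤ 0 ≤ a`. -/
def JForm (J : Set ℝ) : Prop :=
  (∃ b : ℝ, b ≤ 0 ∧ (J = Set.Iio b ∨ J = Set.Iic b)) ∨
  (∃ a : ℝ, 0 ≤ a ∧ (J = Set.Ioi a ∨ J = Set.Ici a)) ∨
  J = Set.univ

namespace S19

/-- An ordered cancellative archimedean commutative semigroup. -/
class OCS (S : Type) [LinearOrder S] extends AddCommSemigroup S where
  lt' : ∀ a b c : S, a < b → a + c < b + c
  arch' : ∀ a b c d : S, b < a → ∃ k : ℕ, (b + ·)^[k] c ≤ (a + ·)^[k] d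

section
variable {S : Type} [LinearOrder S] [OCS S]

theorem lt_iff (a b c : S) : a + c < b + c ↔ a < b := by
  constructor
  · intro h
    by_contra h'
    rcases (not_lt.1 h').lt_or_eq with h2 | h2
    · exact absurd (OCS.lt' _ _ c h2) (not_lt.2 h.le)
    · subst h2; exact lt_irrefl _ h
  · exact OCS.lt' a b c

theorem le_iff (a b c : S) : a + c ≤ b + c ↔ a ≤ b := by
  rw [← not_lt, ← not_lt, lt_iff]

theorem eq_iff (a b c : S) : a + c = b + c ↔ a = b := by
  rw [le_antisymm_iff, le_antisymm_iff, le_iff, le_iff]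

/-- difference equivalence -/
def sd (S : Type) [LinearOrder S] [OCS S] : Setoid (S × S) where
  r p q := p.1 + q.2 = q.1 + p.2
  iseqv := by
    refine ⟨fun p => rfl, fun h => h.symm, ?_⟩
    rintro ⟨a, b⟩ ⟨c, d⟩ ⟨u, v⟩ h1 h2
    simp only at *
    rw [← eq_iff _ _ (c + d)]
    calc a + v + (c + d) = (a + d) + (c + v) := by ac_rfl
      _ = (c + b) + (u + d) := by rw [h1, h2]
      _ = _ := by ac_rfl

/-- difference group -/
def DG (S : Type) [LinearOrder S] [OCS S] : Type := Quotient (sd S)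

def mk (a b : S) : DG S := Quotient.mk (sd S) (a, b)

theorem mk_eq {a b c d : S} : mk a b = mk c d ↔ a + d = c + b :=
  ⟨fun h => Quotient.exact (s := sd S) h, fun h => Quotient.sound (s := sd S) h⟩

theorem ind {P : DG S → Prop} (h : ∀ a b, P (mk a b)) (x : DG S) : P x :=
  Quotient.ind (s := sd S) (fun p => h p.1 p.2) x

def addG : DG S → DG S → DG S :=
  Quotient.lift₂ (s₁ := sd S) (s₂ := sd S) (fun p q => mk (p.1 + q.1) (p.2 + q.2)) (by
    rintro ⟨a, b⟩ ⟨c, d⟩ ⟨a', b'⟩ ⟨c', d'⟩ (h1 : a + b' = a' + b) (h2 : c + d' = c' + d)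
    rw [mk_eq]
    simp only
    calc a + c + (b' + d') = (a + b') + (c + d') := by ac_rfl
      _ = (a' + b) + (c' + d) := by rw [h1, h2]
      _ = _ := by ac_rfl)

def negG : DG S → DG S :=
  Quotient.lift (s := sd S) (fun p => mk p.2 p.1) (by
    rintro ⟨a, b⟩ ⟨a', b'⟩ (h1 : a + b' = a' + b)
    rw [mk_eq]
    simp only
    rw [add_comm b a', ← h1, add_comm])

def leG : DG S → DG S → Prop :=
  Quotient.lift₂ (s₁ := sd S) (s₂ := sd S) (fun p q => p.1 + q.2 ≤ q.1 + p.2) (by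
    rintro ⟨a, b⟩ ⟨c, d⟩ ⟨a', b'⟩ ⟨c', d'⟩ (h1 : a + b' = a' + b) (h2 : c + d' = c' + d)
    simp only [eq_iff_iff]
    rw [← le_iff _ _ (b' + d'), ← le_iff (a' + d') _ (b + d)]
    have e1 : a + d + (b' + d') = (a' + d') + (b + d) := by
      calc a + d + (b' + d') = (a + b') + (d + d') := by ac_rfl
        _ = (a' + b) + (d + d') := by rw [h1]
        _ = _ := by ac_rfl
    have e2 : c + b + (b' + d') = (c' + b') + (b + d) := by
      calc c + b + (b' + d') = (c + d') + (b + b') := by ac_rfl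
        _ = (c' + d) + (b + b') := by rw [h2]
        _ = _ := by ac_rfl
    rw [e1, e2])

set_option linter.unusedSectionVars false
variable [Inhabited S]

instance : Add (DG S) := ⟨addG⟩
instance : Neg (DG S) := ⟨negG⟩
instance : Zero (DG S) := ⟨mk default default⟩
instance : LE (DG S) := ⟨leG⟩

theorem mk_add (a b c d : S) : mk a b + mk c d = mk (a + c) (b + d) := rfl
theorem mk_neg (a b : S) : -mk a b = mk b a := rfl
theorem mk_le (a b c d : S) : mk a b ≤ mk c d ↔ a + d ≤ c + b := Iff.rfl
theorem zero_def : (0 : DG S) = mk default default := rfl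

instance : AddCommGroup (DG S) :=
  AddCommGroup.mk (toAddGroup := AddGroup.ofLeftAxioms
    (by
      intro a b c
      induction a using ind; induction b using ind; induction c using ind
      simp only [mk_add, add_assoc])
    (by
      intro a
      induction a using ind
      rw [zero_def, mk_add, mk_eq]
      ac_rfl)
    (by
      intro a
      induction a using ind
      rw [zero_def, mk_neg, mk_add, mk_eq]
      ac_rfl))
    (by
      intro a b
      induction a using ind; induction b using ind
      simp only [mk_add, add_comm])

noncomputable instance : LinearOrder (DG S) where
  le_refl a := by
    induction a using ind
    rw [mk_le]
  le_trans a b c := by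
    induction a using ind with | _ a a'
    induction b using ind with | _ b b'
    induction c using ind with | _ c c'
    simp only [mk_le]
    intro h1 h2
    rw [← le_iff _ _ (b + b')]
    calc a + c' + (b + b') = (a + b') + (b + c') := by ac_rfl
      _ ≤ (b + a') + (b + c') := (le_iff _ _ _).2 h1
      _ = (b + c') + (b + a') := by ac_rfl
      _ ≤ (c + b') + (b + a') := (le_iff _ _ _).2 h2
      _ = _ := by ac_rfl
  le_antisymm a b := by
    induction a using ind; induction b using ind
    simp only [mk_le, mk_eq]
    exact le_antisymm
  le_total a b := by
    induction a using ind; induction b using ind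
    simp only [mk_le]
    exact le_total _ _
  toDecidableLE := Classical.decRel _

instance : IsOrderedAddMonoid (DG S) where
  add_le_add_left a b := by
    intro h c
    induction a using ind with | _ a a'
    induction b using ind with | _ b b'
    induction c using ind with | _ c c'
    rw [mk_add, mk_add, mk_le]
    rw [mk_le] at h
    calc a + c + (b' + c') = (a + b') + (c + c') := by ac_rfl
      _ ≤ (b + a') + (c + c') := (le_iff _ _ _).2 h
      _ = _ := by ac_rfl

theorem mk_lt (a b c d : S) : mk a b < mk c d ↔ a + d < c + b := by
  rw [← not_le, ← not_le, mk_le]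

theorem iter_add (a : S) (k : ℕ) (u v : S) : (a + ·)^[k] (u + v) = (a + ·)^[k] u + v := by
  induction k with
  | zero => rfl
  | succ k ih => simp only [Function.iterate_succ_apply', ih, add_assoc]

theorem nsmul_mk (a b c d : S) (k : ℕ) :
    k • mk a b + mk c d = mk ((a + ·)^[k] c) ((b + ·)^[k] d) := by
  induction k with
  | zero => simp
  | succ k ih =>
    rw [succ_nsmul', add_assoc, ih, mk_add]
    simp only [Function.iterate_succ_apply']

instance : Archimedean (DG S) where
  arch x y hy := by
    induction x using ind with | _ c d
    induction y using ind with | _ a b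
    rw [zero_def, mk_lt] at hy
    have hab : b < a := by
      rw [add_comm] at hy
      exact (lt_iff _ _ _).1 hy
    obtain ⟨k, hk⟩ := OCS.arch' a b c d hab
    refine ⟨k, ?_⟩
    have h2 : mk d d = (0 : DG S) := by
      rw [zero_def, mk_eq, add_comm]
    rw [← add_zero (k • _), ← h2, nsmul_mk, mk_le, add_comm c, ← iter_add, add_comm, ← iter_add,
      iter_add, iter_add]
    exact (le_iff _ _ _).2 hk

theorem exists_hom : ∃ φ : S → ℝ, StrictMono φ ∧ ∀ a b, φ (a + b) = φ a + φ b := by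
  obtain ⟨E, hE⟩ := Archimedean.exists_orderAddMonoidHom_real_injective (DG S)
  have hEm : StrictMono E := (OrderHomClass.mono E).strictMono_of_injective hE
  refine ⟨fun a => E (mk (a + a) a), ?_, ?_⟩
  · intro a b hab
    apply hEm
    rw [mk_lt]
    calc a + a + b = a + (a + b) := by ac_rfl
      _ < b + (a + b) := (lt_iff _ _ _).2 hab
      _ = _ := by ac_rfl
  · intro a b
    simp only
    rw [← map_add, mk_add]
    congr 2
    ac_rfl
end

section
variable {S : Type} [ConditionallyCompleteLinearOrder S] [TopologicalSpace S] [OrderTopology S]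
  [DenselyOrdered S]

theorem mono_of_canc (op : S → S → S) (hc : Continuous (fun p : S × S => op p.1 p.2))
    (comm : ∀ a b, op a b = op b a) (assoc : ∀ a b c, op (op a b) c = op a (op b c))
    (canc : ∀ a b c, op a c = op b c → a = b) (a b c : S) (hab : a < b) : op a c < op b c := by
  have key : ∀ c, StrictMono (fun x => op x c) ∨ StrictAnti (fun x => op x c) := by
    intro c
    apply Continuous.strictMono_of_inj
    · exact hc.comp (by fun_prop : Continuous fun x : S => (x, c))
    · intro x y h; exact canc _ _ _ h
  by_contra hcon
  have hcon' := (not_lt.1 hcon)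
  have hanti : StrictAnti (fun x => op x c) := by
    rcases key c with h | h
    · exact absurd (h hab) hcon
    · exact h
  have hcc : op a (op c c) < op b (op c c) := by
    rw [← assoc, ← assoc]
    exact hanti (hanti hab)
  have c1 : Continuous (fun x => op a x) := hc.comp (by fun_prop : Continuous fun x : S => (a, x))
  have c2 : Continuous (fun x => op b x) := hc.comp (by fun_prop : Continuous fun x : S => (b, x))
  obtain ⟨z, hz⟩ := intermediate_value_univ₂ (a := op c c) (b := c) c1 c2 hcc.le hcon'
  exact hab.ne (canc _ _ _ hz)

theorem arch_of (op : S → S → S) (hc : Continuous (fun p : S × S => op p.1 p.2))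
    (comm : ∀ a b, op a b = op b a) (assoc : ∀ a b c, op (op a b) c = op a (op b c))
    (canc : ∀ a b c, op a c = op b c → a = b) 
    (mono : ∀ a b c, a < b → op a c < op b c) (a b c d : S) (hba : b < a) :
    ∃ k : ℕ, (op b)^[k] c ≤ (op a)^[k] d := by
  by_contra! hcon
  have mono' : ∀ c, StrictMono (op c) := by
    intro c x y h
    rw [comm c, comm c]; exact mono _ _ _ h
  have cont' : ∀ c, Continuous (op c) := fun c =>
    hc.comp (by fun_prop : Continuous fun x : S => (c, x))
  have hdc : d < c := hcon 0
  have hle : ∀ k, (op b)^[k] d ≤ (op a)^[k] d := by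
    intro k
    induction k with
    | zero => exact le_rfl
    | succ k ih =>
      simp only [Function.iterate_succ_apply']
      exact ((mono' b).monotone ih).trans (mono _ _ _ hba).le
  have hx : ∀ k, ∃ x, x ∈ Set.Icc d c ∧ (op b)^[k] x = (op a)^[k] d := by
    intro k
    exact intermediate_value_Icc hdc.le ((cont' b).iterate k).continuousOn ⟨hle k, (hcon k).le⟩
  choose x hx1 hx2 using hx
  have comm_iter : ∀ k y, op a ((op b)^[k] y) = (op b)^[k] (op a y) := by
    intro k
    induction k with
    | zero => intro y; rfl
    | succ k ih =>
      intro y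
      simp only [Function.iterate_succ_apply]
      rw [ih, ← assoc, comm a b, assoc]
  have hrec : ∀ k, op b (x (k+1)) = op a (x k) := by
    intro k
    apply ((mono' b).iterate k).injective
    rw [← comm_iter, hx2, ← Function.iterate_succ_apply, hx2, Function.iterate_succ_apply']
  have hmono : Monotone x := by
    apply monotone_nat_of_le_succ
    intro k
    by_contra! h
    have := mono' b h
    rw [hrec] at this
    exact absurd this (mono _ _ _ hba).not_gt
  have hbdd : BddAbove (Set.range x) := ⟨c, by rintro _ ⟨k, rfl⟩; exact (hx1 k).2⟩
  have hlim := tendsto_atTop_ciSup hmono hbdd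
  have l1 := ((cont' b).tendsto _).comp (hlim.comp (Filter.tendsto_add_atTop_nat 1))
  have l2 := ((cont' a).tendsto _).comp hlim
  have : (op b) ∘ (x ∘ fun k => k + 1) = op a ∘ x := funext hrec
  rw [this] at l1
  exact hba.ne (canc _ _ _ (tendsto_nhds_unique l1 l2))

theorem binary [Inhabited S] [Uncountable S] [SecondCountableTopology S]
    (op : S → S → S) (hc : Continuous (fun p : S × S => op p.1 p.2))
    (comm : ∀ a b, op a b = op b a) (assoc : ∀ a b c, op (op a b) c = op a (op b c))
    (canc : ∀ a b c, op a c = op b c → a = b) :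
    ∃ φ : S → ℝ, StrictMono φ ∧ Continuous φ ∧ ∀ a b, φ (op a b) = φ a + φ b := by
  have mono := mono_of_canc op hc comm assoc canc
  let inst : OCS S :=
    { add := op
      add_assoc := assoc
      add_comm := comm
      lt' := mono
      arch' := arch_of op hc comm assoc canc mono }
  obtain ⟨φ, hφ, hadd⟩ := exists_hom (S := S)
  replace hadd : ∀ a b, φ (op a b) = φ a + φ b := hadd
  refine ⟨φ, hφ, ?_, hadd⟩
  rw [continuous_iff_continuousAt]
  intro x
  have hcount := hφ.monotone.countable_not_continuousAt
  have : ∃ c, ContinuousAt φ (op c x) := by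
    by_contra! h
    have hc2 := hcount.preimage_of_injOn (f := fun c => op c x) (fun a _ b _ h => canc _ _ _ h)
    have : ((fun c => op c x) ⁻¹' {x | ¬ContinuousAt φ x}) = Set.univ := by
      ext c; simp [h c]
    rw [this] at hc2
    exact not_countable (Set.countable_univ_iff.1 hc2)
  obtain ⟨c, hcx⟩ := this
  have cont' : Continuous (op c) := hc.comp (by fun_prop : Continuous fun x : S => (c, x))
  have h1 : ContinuousAt (fun y => φ (op c y) - φ c) x :=
    (ContinuousAt.comp (g := φ) hcx cont'.continuousAt).sub continuousAt_const
  have h2 : (fun y => φ (op c y) - φ c) = φ := by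
    funext y; rw [hadd]; ring
  rwa [h2] at h1
end

section
open Matrix
variable {S : Type} [ConditionallyCompleteLinearOrder S] [TopologicalSpace S] [OrderTopology S]
  [DenselyOrdered S]

theorem nary [Inhabited S] [Uncountable S] [SecondCountableTopology S] (m : ℕ)
    (F : (Fin (m + 2) → S) → S) (hF : Continuous F)
    (symm : ∀ x (σ : Equiv.Perm (Fin (m + 2))), F (x ∘ σ) = F x)
    (K : ∀ (a z : S) (w : Fin (m + 1) → S) (r : Fin m → S),
      F (vecCons (F (vecCons a w)) (vecCons z r)) = F (vecCons (F (vecCons z w)) (vecCons a r)))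
    (canc : ∀ (a b : S) (w : Fin (m + 1) → S), F (vecCons a w) = F (vecCons b w) → a = b) :
    ∃ φ : S → ℝ, StrictMono φ ∧ Continuous φ ∧ ∀ x, φ (F x) = ∑ i, φ (x i) := by
  let e : S := default
  let op : S → S → S := fun a b => F (vecCons a (vecCons b (fun _ => e)))
  have comm : ∀ a b, op a b = op b a := by
    intro a b
    simp only [op]
    rw [← symm _ (Equiv.swap 0 1)]
    congr 1
    funext i
    refine Fin.cases ?_ (fun j => Fin.cases ?_ (fun l => ?_) j) i
    · simp
    · simp
    · simp only [Function.comp]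
      rw [Equiv.swap_apply_of_ne_of_ne]
      · simp
      · exact Fin.succ_ne_zero _
      · intro h
        have := congrArg Fin.val h
        simp at this
  have assoc : ∀ a b c, op (op a b) c = op a (op b c) := by
    intro a b c
    rw [comm a (op b c), comm b c]
    exact K a c _ _
  have hc : Continuous (fun p : S × S => op p.1 p.2) := by
    apply hF.comp
    apply continuous_pi
    intro i
    refine Fin.cases ?_ (fun j => Fin.cases ?_ (fun l => ?_) j) i
    · exact continuous_fst
    · exact continuous_snd
    · exact continuous_const
  obtain ⟨φ, hφ, hcont, hadd⟩ := binary op hc comm assoc (fun a b c => canc a b _)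
  have step0 : ∀ a z w, φ (F (vecCons a w)) + φ z = φ (F (vecCons z w)) + φ a := by
    intro a z w
    rw [← hadd, ← hadd]
    exact congrArg φ (K a z w _)
  have step : ∀ x k z, φ (F x) + φ z = φ (F (Function.update x k z)) + φ (x k) := by
    intro x k z
    have h1 : x ∘ (Equiv.swap 0 k) = vecCons (x k) (vecTail (x ∘ (Equiv.swap 0 k))) := by
      funext i
      refine Fin.cases ?_ (fun j => ?_) i
      · simp
      · simp [vecTail]
    have h2 : (Function.update x k z) ∘ (Equiv.swap 0 k) =
        vecCons z (vecTail (x ∘ (Equiv.swap 0 k))) := by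
      funext i
      refine Fin.cases ?_ (fun j => ?_) i
      · simp
      · simp only [vecTail, Function.comp, cons_val_succ]
        rw [Function.update_of_ne]
        intro h
        have : Equiv.swap 0 k j.succ = Equiv.swap 0 k 0 := by rw [h]; simp
        exact Fin.succ_ne_zero _ ((Equiv.swap 0 k).injective this)
    rw [← symm x (Equiv.swap 0 k), ← symm (Function.update x k z) (Equiv.swap 0 k), h1, h2]
    exact step0 _ _ _
  let H : (Fin (m + 2) → S) → ℝ := fun x => φ (F x) - ∑ i, φ (x i)
  have hH : ∀ x k, H (Function.update x k e) = H x := by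
    intro x k
    have h1 := step x k e
    have h2 : ∑ i, φ (Function.update x k e i) = φ e + ∑ i ∈ Finset.univ \ {k}, φ (x i) := by
      have := Finset.sum_update_of_mem (Finset.mem_univ k) (fun i => φ (x i)) (φ e)
      rw [← this]
      refine Finset.sum_congr rfl fun i _ => ?_
      by_cases h : i = k
      · subst h; simp
      · simp [h]
    have h3 : ∑ i, φ (x i) = φ (x k) + ∑ i ∈ Finset.univ \ {k}, φ (x i) := by
      have := Finset.sum_update_of_mem (Finset.mem_univ k) (fun i => φ (x i)) (φ (x k))
      rw [← this]
      simp
    simp only [H]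
    linarith
  have hconst : ∀ x, H x = H (fun _ => e) := by
    intro x
    have : ∀ s : Finset (Fin (m + 2)), H (s.piecewise (fun _ => e) x) = H x := by
      intro s
      induction s using Finset.induction_on with
      | empty => simp
      | insert k s hk ih => rw [Finset.piecewise_insert, hH, ih]
    rw [← this Finset.univ]
    simp
  set C := H (fun _ => e) with hC
  have hm : (0:ℝ) < (m:ℝ) + 1 := by positivity
  refine ⟨fun x => φ x + C / (m + 1), fun a b h => by simpa using hφ h,
    hcont.add continuous_const, ?_⟩
  intro x
  have h := hconst x
  simp only [H] at h
  simp only [Finset.sum_add_distrib, Finset.sum_const, Finset.card_univ, Fintype.card_fin,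
    nsmul_eq_mul]
  push_cast
  have : φ (F x) = C + ∑ i, φ (x i) := by linarith
  rw [this]
  field_simp
  ring
end

theorem jform_pos {J : Set ℝ} (hJ : J.OrdConnected) (n : ℕ) (hn : 2 ≤ n)
    (hcl : ∀ y ∈ J, (n : ℝ) * y ∈ J) {y : ℝ} (hy : y ∈ J) (hy0 : 0 < y) :
    Set.Ici y ⊆ J := by
  have hp : ∀ k : ℕ, (n : ℝ) ^ k * y ∈ J := by
    intro k
    induction k with
    | zero => simpa
    | succ k ih => rw [pow_succ', mul_assoc]; exact hcl _ ih
  intro z hz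
  have hn1 : (1:ℝ) < n := by exact_mod_cast hn
  obtain ⟨k, hk⟩ := pow_unbounded_of_one_lt (z / y) hn1
  rw [div_lt_iff₀ hy0] at hk
  exact hJ.out hy (hp k) ⟨hz, hk.le⟩

theorem jform_neg {J : Set ℝ} (hJ : J.OrdConnected) (n : ℕ) (hn : 2 ≤ n)
    (hcl : ∀ y ∈ J, (n : ℝ) * y ∈ J) {y : ℝ} (hy : y ∈ J) (hy0 : y < 0) :
    Set.Iic y ⊆ J := by
  have hp : ∀ k : ℕ, (n : ℝ) ^ k * y ∈ J := by
    intro k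
    induction k with
    | zero => simpa
    | succ k ih => rw [pow_succ', mul_assoc]; exact hcl _ ih
  intro z hz
  have hn1 : (1:ℝ) < n := by exact_mod_cast hn
  obtain ⟨k, hk⟩ := pow_unbounded_of_one_lt (z / y) hn1
  rw [div_lt_iff_of_neg hy0] at hk
  exact hJ.out (hp k) hy ⟨hk.le, hz⟩

theorem jform {J : Set ℝ} (hJ : J.OrdConnected) (n : ℕ) (hn : 2 ≤ n)
    (hcl : ∀ y ∈ J, (n : ℝ) * y ∈ J) (hne : ∃ y ∈ J, y ≠ 0) : JForm J := by
  by_cases hpos : ∃ y ∈ J, 0 < y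
  · obtain ⟨y, hy, hy0⟩ := hpos
    have h1 := jform_pos hJ n hn hcl hy hy0
    by_cases hneg : ∃ z ∈ J, z < 0
    · obtain ⟨z, hz, hz0⟩ := hneg
      have h2 := jform_neg hJ n hn hcl hz hz0
      right; right
      ext t
      simp only [Set.mem_univ, iff_true]
      rcases le_total y t with h | h
      · exact h1 h
      rcases le_total t z with h' | h'
      · exact h2 h'
      exact hJ.out hz hy ⟨h', h⟩
    · push Not at hneg
      right; left
      have hb : BddBelow J := ⟨0, hneg⟩
      refine ⟨sInf J, le_csInf ⟨y, hy⟩ hneg, ?_⟩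
      have hsub : Set.Ioi (sInf J) ⊆ J := by
        intro t ht
        obtain ⟨u, hu, hut⟩ := exists_lt_of_csInf_lt ⟨y, hy⟩ ht
        rcases le_total y t with h | h
        · exact h1 h
        · exact hJ.out hu hy ⟨hut.le, h⟩
      by_cases hm : sInf J ∈ J
      · right
        apply Set.Subset.antisymm
        · intro t ht; exact csInf_le hb ht
        · intro t ht
          rcases (Set.mem_Ici.1 ht).lt_or_eq with h | h
          · exact hsub h
          · rwa [← h]
      · left
        apply Set.Subset.antisymm
        · intro t ht
          exact lt_of_le_of_ne (csInf_le hb ht) (fun h => hm (h ▸ ht))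
        · exact hsub
  · push Not at hpos
    obtain ⟨y, hy, hy0⟩ := hne
    have h1 := jform_neg hJ n hn hcl hy (lt_of_le_of_ne (hpos y hy) hy0)
    left
    have hb : BddAbove J := ⟨0, hpos⟩
    refine ⟨sSup J, csSup_le ⟨y, hy⟩ hpos, ?_⟩
    have hsub : Set.Iio (sSup J) ⊆ J := by
      intro t ht
      obtain ⟨u, hu, hut⟩ := exists_lt_of_lt_csSup ⟨y, hy⟩ ht
      rcases le_total t y with h | h
      · exact h1 h
      · exact hJ.out hy hu ⟨h, hut.le⟩
    by_cases hm : sSup J ∈ J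
    · right
      apply Set.Subset.antisymm
      · intro t ht; exact le_csSup hb ht
      · intro t ht
        rcases (Set.mem_Iic.1 ht).lt_or_eq with h | h
        · exact hsub h
        · rwa [h]
    · left
      apply Set.Subset.antisymm
      · intro t ht
        exact lt_of_le_of_ne (le_csSup hb ht) (fun h => hm (h ▸ ht))
      · exact hsub

theorem jform_conn {J : Set ℝ} (h : JForm J) : J.OrdConnected := by
  rcases h with ⟨b, _, rfl | rfl⟩ | ⟨a, _, rfl | rfl⟩ | rfl
  exacts [Set.ordConnected_Iio, Set.ordConnected_Iic, Set.ordConnected_Ioi, Set.ordConnected_Ici,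
    Set.ordConnected_univ]

theorem sum_assoc (n : ℕ) (g : ℕ → ℝ) (i : ℕ) (hi : i < n) :
    ∑ j : Fin n, (if (j : ℕ) < i then g j
        else if (j : ℕ) = i then ∑ l : Fin n, g (i + (l : ℕ))
        else g ((j : ℕ) + n - 1)) = ∑ j ∈ Finset.range (2 * n - 1), g j := by
  obtain ⟨r, rfl⟩ : ∃ r, n = i + 1 + r := ⟨n - (i + 1), by omega⟩
  rw [Fin.sum_univ_eq_sum_range (fun l => g (i + l)) (i + 1 + r)]
  rw [Fin.sum_univ_eq_sum_range (fun j => if j < i then g j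
        else if j = i then ∑ l ∈ Finset.range (i + 1 + r), g (i + l)
        else g (j + (i + 1 + r) - 1)) (i + 1 + r)]
  have e : 2 * (i + 1 + r) - 1 = i + (i + 1 + r) + r := by omega
  rw [e, Finset.sum_range_add g (i + (i + 1 + r)) r, Finset.sum_range_add g i (i + 1 + r)]
  generalize ∑ l ∈ Finset.range (i + 1 + r), g (i + l) = T
  rw [Finset.sum_range_add _ (i + 1) r, Finset.sum_range_succ]
  congr 1
  · congr 1
    · refine Finset.sum_congr rfl fun j hj => ?_
      rw [if_pos (Finset.mem_range.1 hj)]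
    · simp
  · refine Finset.sum_congr rfl fun j hj => ?_
    rw [if_neg (by omega), if_neg (by omega)]
    congr 1
    omega

theorem reverse (n : ℕ) (I : Set ℝ) (hI : I.OrdConnected)
    (f : (Fin n → ℝ) → ℝ)
    (hmap : ∀ x : Fin n → ℝ, (∀ i, x i ∈ I) → f x ∈ I)
    (φ : ℝ → ℝ) (hJ : JForm (φ '' I)) (hmono : StrictMonoOn φ I) (hcont : ContinuousOn φ I)
    (hf : ∀ x : Fin n → ℝ, (∀ i, x i ∈ I) → φ (f x) = ∑ i : Fin n, φ (x i)) :
    ContinuousOn f {x | ∀ i, x i ∈ I} ∧ SymmOn n I f ∧ CancOn n I f ∧ NAssocOn n I f := by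
  have hJc := jform_conn hJ
  refine ⟨?_, ?_, ?_, ?_⟩
  · have : Set.OrdConnected I := hI
    have : Set.OrdConnected (φ '' I) := hJc
    let E := hmono.orderIso φ I
    have hE : Continuous E.symm := E.symm.continuous
    rw [continuousOn_iff_continuous_domRestrict]
    have hsum : ∀ x : {x : Fin n → ℝ | ∀ i, x i ∈ I}, ∑ i, φ (x.1 i) ∈ φ '' I := fun x =>
      ⟨f x.1, hmap _ x.2, hf _ x.2⟩
    have heq : Set.domRestrict {x : Fin n → ℝ | ∀ i, x i ∈ I} f =
        fun x => ((E.symm ⟨∑ i, φ (x.1 i), hsum x⟩ : I) : ℝ) := by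
      funext x
      have : E ⟨f x.1, hmap _ x.2⟩ = ⟨∑ i, φ (x.1 i), hsum x⟩ := by
        apply Subtype.ext
        exact hf _ x.2
      rw [← this, OrderIso.symm_apply_apply]
      rfl
    rw [heq]
    refine continuous_subtype_val.comp (hE.comp (Continuous.subtype_mk ?_ _))
    refine continuous_finsetSum _ fun i _ => ?_
    exact hcont.comp_continuous ((continuous_apply i).comp continuous_subtype_val) (fun x => x.2 i)
  · intro x hx σ
    apply hmono.injOn (hmap _ fun i => hx _) (hmap _ hx)
    rw [hf _ hx, hf _ fun i => hx _]
    exact Equiv.sum_comp σ (fun i => φ (x i))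
  · intro k x x' hx hx' h he
    apply hmono.injOn (hx k) (hx' k)
    have h1 := hf x hx
    rw [he, hf x' hx', ← Finset.add_sum_erase _ _ (Finset.mem_univ k),
      ← Finset.add_sum_erase _ (fun i => φ (x i)) (Finset.mem_univ k)] at h1
    have : ∑ i ∈ Finset.univ.erase k, φ (x' i) = ∑ i ∈ Finset.univ.erase k, φ (x i) :=
      Finset.sum_congr rfl fun i hi => by rw [h i (Finset.ne_of_mem_erase hi)]
    linarith
  · intro x hx i hi
    have key : ∀ i, i < n → 
        (∀ j : Fin n, (if (j : ℕ) < i then x j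
          else if (j : ℕ) = i then f (fun l : Fin n => x (i + (l : ℕ)))
          else x ((j : ℕ) + n - 1)) ∈ I) ∧
        φ (f (fun j : Fin n => if (j : ℕ) < i then x j
          else if (j : ℕ) = i then f (fun l : Fin n => x (i + (l : ℕ)))
          else x ((j : ℕ) + n - 1))) = ∑ j ∈ Finset.range (2 * n - 1), φ (x j) := by
      intro i hi
      have hin : ∀ l : Fin n, x (i + (l : ℕ)) ∈ I := fun l => hx _ (by omega)
      have h1 : (∀ j : Fin n, (if (j : ℕ) < i then x j
          else if (j : ℕ) = i then f (fun l : Fin n => x (i + (l : ℕ)))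
          else x ((j : ℕ) + n - 1)) ∈ I) := by
        intro j
        split_ifs
        · exact hx _ (by omega)
        · exact hmap _ hin
        · exact hx _ (by omega)
      refine ⟨h1, ?_⟩
      rw [hf _ h1, ← sum_assoc n (fun j => φ (x j)) i hi]
      refine Finset.sum_congr rfl fun j _ => ?_
      split_ifs
      · rfl
      · rw [hf _ hin]
      · rfl
    obtain ⟨a1, a2⟩ := key i (by omega)
    obtain ⟨b1, b2⟩ := key (i + 1) hi
    exact hmono.injOn (hmap _ a1) (hmap _ b1) (a2.trans b2.symm)

theorem forward (m : ℕ) (I : Set ℝ) (hI : I.OrdConnected)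
    (hne : ∃ a ∈ I, ∃ b ∈ I, a ≠ b)
    (f : (Fin (m + 2) → ℝ) → ℝ)
    (hmap : ∀ x : Fin (m + 2) → ℝ, (∀ i, x i ∈ I) → f x ∈ I)
    (hc : ContinuousOn f {x | ∀ i, x i ∈ I}) (hs : SymmOn (m + 2) I f)
    (hcanc : CancOn (m + 2) I f) (ha : NAssocOn (m + 2) I f) :
    ∃ φ : ℝ → ℝ, ∃ J : Set ℝ, JForm J ∧
        StrictMonoOn φ I ∧ ContinuousOn φ I ∧ φ '' I = J ∧
        ∀ x : Fin (m + 2) → ℝ, (∀ i, x i ∈ I) → φ (f x) = ∑ i, φ (x i) := by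
  classical
  have hIc : Set.OrdConnected I := hI
  obtain ⟨p, hp, q, hq, hpq⟩ : ∃ a ∈ I, ∃ b ∈ I, a < b := by
    obtain ⟨a, ha, b, hb, h⟩ := hne
    rcases h.lt_or_gt with h | h
    · exact ⟨a, ha, b, hb, h⟩
    · exact ⟨b, hb, a, ha, h⟩
  let inh : Inhabited I := ⟨⟨p, hp⟩⟩
  have unc : Uncountable I := by
    rw [← not_countable_iff]
    intro h
    have h1 : (Set.Icc p q).Countable := (Set.countable_coe_iff.1 h).mono (hI.out hp hq)
    have := Cardinal.mk_Icc_real hpq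
    have h2 := Cardinal.le_aleph0_iff_set_countable.2 h1
    rw [this] at h2
    exact absurd h2 (not_le.2 Cardinal.aleph0_lt_continuum)
  let F : (Fin (m + 2) → I) → I := fun x => ⟨f (fun i => x i), hmap _ fun i => (x i).2⟩
  have hF : Continuous F := by
    refine Continuous.subtype_mk ?_ _
    exact hc.comp_continuous (by fun_prop) (fun x i => (x i).2)
  have symm : ∀ x (σ : Equiv.Perm (Fin (m + 2))), F (x ∘ σ) = F x := fun x σ =>
    Subtype.ext (hs (fun i => x i) (fun i => (x i).2) σ)
  have canc : ∀ (a b : I) (w : Fin (m + 1) → I),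
      F (Matrix.vecCons a w) = F (Matrix.vecCons b w) → a = b := by
    intro a b w h
    have := hcanc 0 (fun i => (Matrix.vecCons a w i : I)) (fun i => (Matrix.vecCons b w i : I))
      (fun i => Subtype.property _) (fun i => Subtype.property _) (by
        intro i hi
        obtain ⟨j, rfl⟩ := Fin.exists_succ_eq.2 hi
        simp) (congrArg Subtype.val h)
    exact Subtype.ext this
  have K : ∀ (a z : I) (w : Fin (m + 1) → I) (r : Fin m → I),
      F (Matrix.vecCons (F (Matrix.vecCons a w)) (Matrix.vecCons z r)) =
      F (Matrix.vecCons (F (Matrix.vecCons z w)) (Matrix.vecCons a r)) := by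
    intro a z w r
    -- the sequence a, w, z, r
    let x : ℕ → I := fun j => if j = 0 then a else
      if h : j - 1 < m + 1 then w ⟨j - 1, h⟩ else if j = m + 2 then z else
      if h : j - (m + 3) < m then r ⟨j - (m + 3), h⟩ else a
    have hx0 : x 0 = a := by simp [x]
    have hxw : ∀ j : Fin (m + 1), x (j + 1) = w j := by
      intro j
      simp only [x]
      rw [if_neg (by omega), dif_pos (by omega)]
      rfl
    have hxz : x (m + 2) = z := by simp [x]
    have hxr : ∀ j : Fin m, x (j + m + 3) = r j := by
      intro j
      simp only [x]
      rw [if_neg (by omega), dif_neg (by omega), if_neg (by omega), dif_pos (by omega)]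
      congr 1
      apply Fin.ext
      simp only
      omega
    have h := ha (fun j => x j) (fun j _ => (x j).2) 0 (by omega)
    have hL : F (Matrix.vecCons (F (Matrix.vecCons a w)) (Matrix.vecCons z r)) =
        F (Matrix.vecCons a (Matrix.vecCons (F (fun l => x (0 + 1 + (l : ℕ)))) r)) := by
      apply Subtype.ext
      refine Eq.trans ?_ (h.trans ?_)
      · change f _ = f _
        congr 1
        funext i
        refine Fin.cases ?_ (fun j => Fin.cases ?_ (fun l => ?_) j) i
        · simp only [Matrix.cons_val_zero, Fin.val_zero, lt_irrefl, if_false, if_true]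
          change f _ = f _
          congr 1
          funext l
          refine Fin.cases ?_ (fun l => ?_) l
          · simp [hx0]
          · simp [hxw]
        · simp [← hxz, add_comm]
        · simp only [Matrix.cons_val_succ, ← hxr]
          simp
          congr 2
          omega
      · change f _ = f _
        congr 1
        funext i
        refine Fin.cases ?_ (fun j => Fin.cases ?_ (fun l => ?_) j) i
        · simp [hx0]
        · simp [F]
        · simp only [Matrix.cons_val_succ, ← hxr]
          simp
          congr 2
          omega
    have hR : F (fun l => x (0 + 1 + (l : ℕ))) = F (Matrix.vecCons z w) := by
      rw [← symm (Matrix.vecCons z w) (finRotate (m + 2))]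
      congr 1
      funext i
      refine Fin.lastCases ?_ (fun j => ?_) i
      · simp only [Function.comp, finRotate_last, Matrix.cons_val_zero, ← hxz]
        congr 1
        simp; omega
      · simp only [Function.comp]
        have : finRotate (m + 2) j.castSucc = j.succ := by
          rw [finRotate_succ_apply]; exact Fin.coeSucc_eq_succ
        rw [this, Matrix.cons_val_succ, ← hxw]
        congr 1
        simp; omega
    rw [hL, hR, ← symm _ (Equiv.swap 0 1)]
    congr 1
    funext i
    refine Fin.cases ?_ (fun j => Fin.cases ?_ (fun l => ?_) j) i
    · simp
    · simp
    · simp only [Function.comp]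
      rw [Equiv.swap_apply_of_ne_of_ne]
      · simp
      · exact Fin.succ_ne_zero _
      · intro h
        have := congrArg Fin.val h
        simp at this
  obtain ⟨φ, hφ, hcφ, hsum⟩ := nary m F hF symm K canc
  let Φ : ℝ → ℝ := fun t => if h : t ∈ I then φ ⟨t, h⟩ else 0
  have hΦ : ∀ t : I, Φ t = φ t := fun t => by simp [Φ]
  have hmonoΦ : StrictMonoOn Φ I := by
    intro s hs t ht hst
    have h1 := hΦ ⟨s, hs⟩
    have h2 := hΦ ⟨t, ht⟩
    simp only at h1 h2
    rw [h1, h2]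
    exact hφ hst
  have hcΦ : ContinuousOn Φ I := by
    rw [continuousOn_iff_continuous_domRestrict]
    have : Set.domRestrict I Φ = φ := funext hΦ
    rwa [this]
  have hsumΦ : ∀ x : Fin (m + 2) → ℝ, (∀ i, x i ∈ I) → Φ (f x) = ∑ i, Φ (x i) := by
    intro x hx
    have h1 := hsum (fun i => ⟨x i, hx i⟩)
    simp only [← hΦ] at h1
    exact h1
  refine ⟨Φ, Φ '' I, ?_, hmonoΦ, hcΦ, rfl, hsumΦ⟩
  refine jform ?_ (m + 2) (by omega) ?_ ?_
  · exact (hI.isPreconnected.image Φ hcΦ).ordConnected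
  · rintro _ ⟨t, ht, rfl⟩
    refine ⟨f (fun _ => t), hmap _ fun _ => ht, ?_⟩
    rw [hsumΦ _ fun _ => ht]
    simp
  · have h := hmonoΦ hp hq hpq
    by_cases h0 : Φ p = 0
    · exact ⟨_, ⟨q, hq, rfl⟩, by linarith⟩
    · exact ⟨_, ⟨p, hp, rfl⟩, h0⟩

end S19

/-- Main Theorem: `f : Iⁿ → I` on a nontrivial real interval `I` is continuous,
symmetric, cancellative and associative iff there is a continuous strictly increasing
`φ` from `I` onto an interval `J` of one of the forms `(-∞,b)`, `(-∞,b]`, `(a,∞)`,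
`[a,∞)`, `ℝ` (`b ≤ 0 ≤ a`) such that `f(x₁,…,xₙ) = φ⁻¹(∑ᵢ φ(xᵢ))` on `Iⁿ`. -/
theorem stmt_19 (n : ℕ) (hn : 2 ≤ n) (I : Set ℝ) (hI : I.OrdConnected)
    (hne : ∃ a ∈ I, ∃ b ∈ I, a ≠ b)
    (f : (Fin n → ℝ) → ℝ)
    (hmap : ∀ x : Fin n → ℝ, (∀ i, x i ∈ I) → f x ∈ I) :
    (ContinuousOn f {x | ∀ i, x i ∈ I} ∧ SymmOn n I f ∧ CancOn n I f ∧
        NAssocOn n I f) ↔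
      ∃ φ : ℝ → ℝ, ∃ J : Set ℝ, JForm J ∧
        StrictMonoOn φ I ∧ ContinuousOn φ I ∧ φ '' I = J ∧
        ∀ x : Fin n → ℝ, (∀ i, x i ∈ I) → φ (f x) = ∑ i : Fin n, φ (x i) := by
  constructor
  · rintro ⟨hc, hs, hcanc, ha⟩
    obtain ⟨m, rfl⟩ : ∃ m, n = m + 2 := ⟨n - 2, by omega⟩
    exact S19.forward m I hI hne f hmap hc hs hcanc ha
  · rintro ⟨φ, J, hJ, hmono, hcont, rfl, hf⟩
    exact S19.reverse n I hI f hmap φ hJ hmono hcont hf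
end
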